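/- arXiv:1404.4626 — 2 statements merged into one kernel-verified Lean document; each statement's English description precedes it below -/
import Mathlib

section
/- Let X be a δ-hyperbolic geodesic metric space and G a group acting on X by isometries. If the limit set of G in the Gromov boundary ∂X is nonempty and G has no finite orbit in ∂X, then G contains two loxodromic isometries with disjoint fixed-point pairs that generate a free subgroup of rank two. -/
open Filter

/-- A metric space is geodesic if any two points are joined by an isometric segment. -/
def IsGeodesicSpace (X : Type*) [MetricSpace X] : Prop :=
  ∀ x y : X, ∃ f : ℝ → X, f 0 = x ∧ f (dist x y) = y ∧
    ∀ s ∈ Set.Icc (0 : ℝ) (dist x y), ∀ t ∈ Set.Icc (0 : ℝ) (dist x y),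
      dist (f s) (f t) = |s - t|

/-- The Gromov product (x|y)_o. -/
noncomputable def gromovProd {X : Type*} [MetricSpace X] (o x y : X) : ℝ :=
  (dist o x + dist o y - dist x y) / 2

/-- δ-hyperbolicity via the Gromov product four-point inequality. -/
def IsGromovHyperbolic (X : Type*) [MetricSpace X] (δ : ℝ) : Prop :=
  ∀ o x y z : X, min (gromovProd o x y) (gromovProd o y z) - δ ≤ gromovProd o x z

/-- A sequence converges to a point of the Gromov boundary if the Gromov products of its
terms tend to infinity. -/
def GromovSeq {X : Type*} [MetricSpace X] (u : ℕ → X) : Prop :=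
  ∀ o : X, Tendsto (fun p : ℕ × ℕ => gromovProd o (u p.1) (u p.2)) atTop atTop

/-- Two sequences converge to the same boundary point if the mutual Gromov products tend to
infinity. -/
def GromovEquiv {X : Type*} [MetricSpace X] (u v : ℕ → X) : Prop :=
  GromovSeq u ∧ GromovSeq v ∧
    ∀ o : X, Tendsto (fun p : ℕ × ℕ => gromovProd o (u p.1) (v p.2)) atTop atTop

/-- An isometric group action is loxodromic at g if the stable translation length
lim d(x, gⁿx)/n is positive. -/
def Loxodromic {G X : Type*} [Group G] [MulAction G X] [MetricSpace X] (g : G) : Prop :=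
  ∃ L : ℝ, 0 < L ∧ ∀ x : X, Tendsto (fun n : ℕ => dist x ((g ^ n) • x) / n) atTop (nhds L)

section GromovProduct

variable {X : Type*} [MetricSpace X]

lemma gromovProd_comm (o x y : X) : gromovProd o x y = gromovProd o y x := by
  unfold gromovProd
  rw [dist_comm x y]
  ring

lemma gromovProd_self (o x : X) : gromovProd o x x = dist o x := by
  simp [gromovProd]

lemma gromovProd_le_add (o o' x x' y y' : X) :
    gromovProd o x y ≤ gromovProd o' x' y' + dist o o' + dist x x' + dist y y' := by
  have h1 := dist_triangle4 o o' x' x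
  have h2 := dist_triangle4 o o' y' y
  have h3 := dist_triangle4 x' x y y'
  rw [dist_comm x' x] at h1 h3
  rw [dist_comm y' y] at h2
  unfold gromovProd
  linarith

lemma gromovProd_smul {G : Type*} [Group G] [MulAction G X] [IsIsometricSMul G X]
    (g : G) (o x y : X) : gromovProd o (g • x) (g • y) = gromovProd (g⁻¹ • o) x y := by
  have h (z : X) : dist o (g • z) = dist (g⁻¹ • o) z := by
    rw [← dist_smul g (g⁻¹ • o) z, smul_inv_smul]
  simp only [gromovProd, h, dist_smul]

lemma tendsto_gromovProd_iff (o : X) (u v : ℕ → X) :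
    Tendsto (fun p : ℕ × ℕ => gromovProd o (u p.1) (v p.2)) atTop atTop ↔
      ∀ R : ℝ, ∃ N, ∀ n ≥ N, ∀ m ≥ N, R ≤ gromovProd o (u n) (v m) := by
  rw [tendsto_atTop]
  refine forall_congr' fun R => ?_
  rw [eventually_atTop]
  constructor
  · rintro ⟨⟨a, b⟩, h⟩
    exact ⟨max a b, fun n hn m hm =>
      h (n, m) ⟨(le_max_left a b).trans hn, (le_max_right a b).trans hm⟩⟩
  · rintro ⟨N, h⟩
    exact ⟨(N, N), fun p hp => h p.1 hp.1 p.2 hp.2⟩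

lemma tendsto_gromovProd_of_dist_le {o : X} (o' : X) {u u' v v' : ℕ → X} {C D : ℝ}
    (h : Tendsto (fun p : ℕ × ℕ => gromovProd o (u p.1) (v p.2)) atTop atTop)
    (hu : ∀ n, dist (u n) (u' n) ≤ C) (hv : ∀ n, dist (v n) (v' n) ≤ D) :
    Tendsto (fun p : ℕ × ℕ => gromovProd o' (u' p.1) (v' p.2)) atTop atTop := by
  refine tendsto_atTop_mono (fun p => ?_)
    (tendsto_atTop_add_const_right _ (-(dist o o' + C + D)) h)
  have := gromovProd_le_add o o' (u p.1) (u' p.1) (v p.2) (v' p.2)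
  linarith [hu p.1, hv p.2]

lemma tendsto_gromovProd_basepoint {o : X} (o' : X) {u v : ℕ → X}
    (h : Tendsto (fun p : ℕ × ℕ => gromovProd o (u p.1) (v p.2)) atTop atTop) :
    Tendsto (fun p : ℕ × ℕ => gromovProd o' (u p.1) (v p.2)) atTop atTop :=
  tendsto_gromovProd_of_dist_le (C := 0) (D := 0) o' h (by simp) (by simp)

lemma GromovSeq.equiv_refl {u : ℕ → X} (hu : GromovSeq u) : GromovEquiv u u :=
  ⟨hu, hu, hu⟩

lemma GromovEquiv.symm {u v : ℕ → X} (h : GromovEquiv u v) : GromovEquiv v u := by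
  refine ⟨h.2.1, h.1, fun o => ?_⟩
  have := h.2.2 o
  rw [tendsto_gromovProd_iff] at this ⊢
  intro R
  obtain ⟨N, hN⟩ := this R
  exact ⟨N, fun n hn m hm => gromovProd_comm o (u m) (v n) ▸ hN m hm n hn⟩

lemma GromovEquiv.trans {δ : ℝ} (hhyp : IsGromovHyperbolic X δ) {u v w : ℕ → X}
    (h : GromovEquiv u v) (h' : GromovEquiv v w) : GromovEquiv u w := by
  refine ⟨h.1, h'.2.1, fun o => ?_⟩
  have h1 := h.2.2 o
  have h2 := h'.2.2 o
  rw [tendsto_gromovProd_iff] at h1 h2 ⊢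
  intro R
  obtain ⟨N, hN⟩ := h1 (R + δ)
  obtain ⟨M, hM⟩ := h2 (R + δ)
  refine ⟨max N M, fun n hn m hm => ?_⟩
  have a := hN n (le_of_max_le_left hn) (max N M) (le_max_left _ _)
  have b := hM (max N M) (le_max_right _ _) m (le_of_max_le_right hm)
  linarith [hhyp o (u n) (v (max N M)) (w m), le_min a b]

/-- Sequences converging to distinct boundary points have bounded mutual Gromov products. -/
lemma exists_gromovProd_le_of_not_equiv {δ : ℝ} (hhyp : IsGromovHyperbolic X δ) {u v : ℕ → X}
    (hu : GromovSeq u) (hv : GromovSeq v) (h : ¬ GromovEquiv u v) (o : X) :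
    ∃ C : ℝ, ∀ᶠ n in atTop, gromovProd o (u n) (v n) ≤ C := by
  have h' : ¬ Tendsto (fun p : ℕ × ℕ => gromovProd o (u p.1) (v p.2)) atTop atTop :=
    fun hT => h ⟨hu, hv, fun o' => tendsto_gromovProd_basepoint o' hT⟩
  rw [tendsto_gromovProd_iff] at h'
  push Not at h'
  obtain ⟨R, hR⟩ := h'
  obtain ⟨N, hN⟩ := (tendsto_gromovProd_iff o u u).1 (hu o) (R + δ)
  obtain ⟨M, hM⟩ := (tendsto_gromovProd_iff o v v).1 (hv o) (R + 2 * δ)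
  obtain ⟨n, hn, m, hm, hnm⟩ := hR (max N M)
  refine ⟨R + 2 * δ, eventually_atTop.2 ⟨max N M, fun k hk => ?_⟩⟩
  have a := hN n (le_of_max_le_left hn) k (le_of_max_le_left hk)
  have b := hM k (le_of_max_le_right hk) m (le_of_max_le_right hm)
  have c := hhyp o (u n) (u k) (v m)
  have d := hhyp o (u k) (v k) (v m)
  by_contra! hlt
  have e : R + δ ≤ gromovProd o (u k) (v m) := by linarith [le_min hlt.le b]
  linarith [le_min a e]

lemma GromovSeq.tendsto_dist {u : ℕ → X} (hu : GromovSeq u) (o : X) :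
    Tendsto (fun n => dist o (u n)) atTop atTop := by
  have h : Tendsto (fun n : ℕ => (n, n)) atTop atTop := tendsto_atTop_diagonal
  simpa [Function.comp_def, gromovProd_self] using (hu o).comp h

end GromovProduct

section Orbits

variable {G X : Type*} [Group G] [MetricSpace X] [MulAction G X] [IsIsometricSMul G X]

lemma GromovSeq.smul {u : ℕ → X} (hu : GromovSeq u) (g : G) : GromovSeq fun n => g • u n :=
  fun o => by simpa only [gromovProd_smul] using hu (g⁻¹ • o)

lemma GromovEquiv.smul {u v : ℕ → X} (h : GromovEquiv u v) (g : G) :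
    GromovEquiv (fun n => g • u n) fun n => g • v n :=
  ⟨h.1.smul g, h.2.1.smul g,
    fun o => by simpa only [gromovProd_smul] using h.2.2 (g⁻¹ • o)⟩

/-- Without finite orbits on the boundary, every boundary point can be moved off any finite set. -/
lemma exists_smul_not_gromovEquiv {δ : ℝ} (hhyp : IsGromovHyperbolic X δ)
    (hnofin : ¬ ∃ (k : ℕ) (u : Fin k → ℕ → X), 0 < k ∧ (∀ i, GromovSeq (u i)) ∧
      ∀ (g : G) (i : Fin k), ∃ j : Fin k, GromovEquiv (fun n => g • u i n) (u j))
    {v : ℕ → X} (hv : GromovSeq v) {m : ℕ} (y : Fin m → ℕ → X) :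
    ∃ g : G, ∀ j, ¬ GromovEquiv (fun n => g • v n) (y j) := by
  classical
  by_contra! hcon
  refine hnofin ⟨m, fun j => if ∃ g : G, GromovEquiv (fun n => g • v n) (y j) then y j else v,
    ?_, ?_, ?_⟩
  · obtain ⟨j, -⟩ := hcon 1
    exact j.pos
  · intro i
    dsimp only
    split_ifs with h
    · obtain ⟨g, hg⟩ := h
      exact hg.2.1
    · exact hv
  · intro g i
    have key : ∃ f : G, GromovEquiv (fun n => f • v n)
        (if ∃ g : G, GromovEquiv (fun n => g • v n) (y i) then y i else v) := by
      split_ifs with h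
      · exact h
      · exact ⟨1, by simpa using hv.equiv_refl⟩
    obtain ⟨f, hf⟩ := key
    obtain ⟨j, hj⟩ := hcon (g * f)
    refine ⟨j, ?_⟩
    dsimp only
    rw [if_pos (⟨g * f, hj⟩ : ∃ g : G, GromovEquiv (fun n => g • v n) (y j))]
    refine (hf.smul g).symm.trans hhyp ?_
    simpa only [smul_smul] using hj

end Orbits

section Schottky

variable {G X α : Type*} [Group G] [MetricSpace X] [MulAction G X]

/-- The group element represented by a letter of the free group. -/
def letterVal (φ : α → G) (p : α × Bool) : G := cond p.2 (φ p.1) (φ p.1)⁻¹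

/-- Distinct letters move `o` in directions with Gromov product at most `A`, and every generator
moves `o` far compared with `A` and `δ`. -/
structure IsSchottky (δ A : ℝ) (o : X) (φ : α → G) : Prop where
  nonneg : 0 ≤ A
  gromovProd_le : ∀ p q : α × Bool, p ≠ q →
    gromovProd o (letterVal φ p • o) (letterVal φ q • o) ≤ A
  le_dist : ∀ a, 2 * A + 3 * δ + 1 ≤ dist o (φ a • o)

/-- Generators whose letters converge to pairwise distinct boundary points are eventually in
Schottky position. -/
lemma exists_isSchottky [Finite α] {δ : ℝ} (hhyp : IsGromovHyperbolic X δ) (o : X)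
    (φ : ℕ → α → G) (z : α × Bool → ℕ → X) (hz : ∀ p, GromovSeq (z p))
    (hne : ∀ p q, p ≠ q → ¬ GromovEquiv (z p) (z q)) (D : ℝ)
    (hD : ∀ n p, dist (letterVal (φ n) p • o) (z p n) ≤ D) :
    ∃ (A : ℝ) (n : ℕ), IsSchottky δ A o (φ n) := by
  have h1 : ∀ r : (α × Bool) × (α × Bool), ∃ C : ℝ, ∀ᶠ n in atTop,
      r.1 ≠ r.2 → gromovProd o (z r.1 n) (z r.2 n) ≤ C := by
    intro r
    by_cases hr : r.1 = r.2
    · exact ⟨0, by simp [hr]⟩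
    · obtain ⟨C, hC⟩ := exists_gromovProd_le_of_not_equiv hhyp (hz r.1) (hz r.2) (hne _ _ hr) o
      exact ⟨C, hC.mono fun n hn _ => hn⟩
  choose C hC using h1
  obtain ⟨M, hM⟩ := Finite.exists_le C
  set A : ℝ := max 0 (M + 2 * D)
  have h2 : ∀ᶠ n in atTop, ∀ a : α, 2 * A + 3 * δ + 1 + D ≤ dist o (z (a, true) n) :=
    eventually_all.2 fun a => ((hz (a, true)).tendsto_dist o).eventually_ge_atTop _
  obtain ⟨n, hn1, hn2⟩ := ((eventually_all.2 hC).and h2).exists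
  refine ⟨A, n, le_max_left _ _, fun p q hpq => ?_, fun a => ?_⟩
  · have e1 := hn1 (p, q) hpq
    have e2 := gromovProd_le_add o o (letterVal (φ n) p • o) (z p n)
      (letterVal (φ n) q • o) (z q n)
    rw [dist_self] at e2
    refine le_trans ?_ (le_max_right _ _)
    linarith [hD n p, hD n q, hM (p, q)]
  · have e1 := hn2 a
    have e2 := hD n (a, true)
    have e3 := dist_triangle o (φ n a • o) (z (a, true) n)
    simp only [letterVal, cond_true] at e2
    linarith

variable [IsIsometricSMul G X] {δ A : ℝ} {o : X} {φ : α → G}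

lemma dist_inv_smul_self (g : G) (o : X) : dist o (g⁻¹ • o) = dist o (g • o) := by
  rw [← dist_smul g o (g⁻¹ • o), smul_inv_smul, dist_comm]

/-- Splitting off the first letter of a word. -/
lemma gromovProd_mul_smul (g k : G) (o : X) :
    gromovProd o (g • o) ((g * k) • o) =
      dist o (g • o) - gromovProd o (g⁻¹ • o) (k • o) := by
  have h : dist (g⁻¹ • o) (k • o) = dist o ((g * k) • o) := by
    rw [← dist_smul g (g⁻¹ • o), smul_inv_smul, smul_smul]
  have h' : dist (g • o) ((g * k) • o) = dist o (k • o) := by rw [mul_smul, dist_smul]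
  simp only [gromovProd, h, h', dist_inv_smul_self]
  ring

lemma dist_mul_smul (g k : G) (o : X) :
    dist o ((g * k) • o) =
      dist o (g • o) + dist o (k • o) - 2 * gromovProd o (g⁻¹ • o) (k • o) := by
  have h : dist (g⁻¹ • o) (k • o) = dist o ((g * k) • o) := by
    rw [← dist_smul g (g⁻¹ • o), smul_inv_smul, smul_smul]
  simp only [gromovProd, h, dist_inv_smul_self]
  ring

lemma letterVal_not (φ : α → G) (a : α) (b : Bool) :
    letterVal φ (a, !b) = (letterVal φ (a, b))⁻¹ := by
  cases b <;> simp [letterVal]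

namespace IsSchottky

lemma le_dist_letterVal (h : IsSchottky δ A o φ) (p : α × Bool) :
    2 * A + 3 * δ + 1 ≤ dist o (letterVal φ p • o) := by
  obtain ⟨a, _ | _⟩ := p
  · simpa [letterVal, dist_inv_smul_self] using h.le_dist a
  · simpa [letterVal] using h.le_dist a

/-- Reduced words stay in the direction of their first letter, and do not backtrack. -/
lemma reduced_word (h : IsSchottky δ A o φ) (hδ : 0 ≤ δ) (hhyp : IsGromovHyperbolic X δ)
    (p : α × Bool) (l : List (α × Bool)) (hl : FreeGroup.IsReduced (p :: l)) :
    gromovProd o ((letterVal φ p)⁻¹ • o) ((l.map (letterVal φ)).prod • o) ≤ A + δ := by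
  induction l generalizing p with
  | nil =>
    have : gromovProd o ((letterVal φ p)⁻¹ • o) o = 0 := by
      simp [gromovProd, dist_comm]
    simp only [List.map_nil, List.prod_nil, one_smul, this]
    linarith [h.nonneg]
  | cons q l ih =>
    have hpq : (p.1, !p.2) ≠ q := by
      rintro rfl
      rw [FreeGroup.isReduced_cons_cons] at hl
      simpa using hl.1 rfl
    have hq := ih q (hl.of_cons)
    have h1 := gromovProd_mul_smul (letterVal φ q) (l.map (letterVal φ)).prod o
    have h2 := h.gromovProd_le _ _ hpq
    rw [letterVal_not] at h2
    have h3 := hhyp o ((letterVal φ p)⁻¹ • o)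
      ((letterVal φ q * (l.map (letterVal φ)).prod) • o) (letterVal φ q • o)
    have h4 := h.le_dist_letterVal q
    rw [List.map_cons, List.prod_cons]
    rw [gromovProd_comm] at h1
    by_contra! hlt
    have : A + δ < min (gromovProd o ((letterVal φ p)⁻¹ • o)
        ((letterVal φ q * (l.map (letterVal φ)).prod) • o))
        (gromovProd o ((letterVal φ q * (l.map (letterVal φ)).prod) • o) (letterVal φ q • o)) :=
      lt_min hlt (by linarith)
    have h2' : gromovProd o ((letterVal φ p)⁻¹ • o) (letterVal φ q • o) ≤ A := h2
    linarith

lemma length_le_dist (h : IsSchottky δ A o φ) (hδ : 0 ≤ δ) (hhyp : IsGromovHyperbolic X δ)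
    (l : List (α × Bool)) (hl : FreeGroup.IsReduced l) :
    (l.length : ℝ) ≤ dist o ((l.map (letterVal φ)).prod • o) := by
  induction l with
  | nil => simp
  | cons p l ih =>
    have h1 := ih hl.of_cons
    have h2 := h.reduced_word hδ hhyp p l hl
    have h3 := h.le_dist_letterVal p
    rw [List.map_cons, List.prod_cons, dist_mul_smul]
    push_cast [List.length_cons]
    linarith

lemma lift_injective (h : IsSchottky δ A o φ) (hδ : 0 ≤ δ) (hhyp : IsGromovHyperbolic X δ) :
    Function.Injective (FreeGroup.lift φ) := by
  classical
  rw [injective_iff_map_eq_one]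
  intro x hx
  have h1 := h.length_le_dist hδ hhyp x.toWord FreeGroup.isReduced_toWord
  have h2 : (x.toWord.map (letterVal φ)).prod = 1 := by
    rw [← hx]
    conv_rhs => rw [← FreeGroup.mk_toWord (x := x), FreeGroup.lift_mk]
    rfl
  rw [h2, one_smul, dist_self] at h1
  rw [← FreeGroup.toWord_eq_nil_iff]
  exact List.length_eq_zero_iff.1 (by exact_mod_cast le_antisymm h1 (by positivity))

lemma isReduced_replicate (p : α × Bool) (n : ℕ) :
    FreeGroup.IsReduced (List.replicate n p) := by
  unfold FreeGroup.IsReduced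
  exact List.isChain_replicate_of_rel n fun _ => rfl

lemma le_dist_pow (h : IsSchottky δ A o φ) (hδ : 0 ≤ δ) (hhyp : IsGromovHyperbolic X δ)
    (p : α × Bool) (n : ℕ) : (n : ℝ) ≤ dist o (letterVal φ p ^ n • o) := by
  simpa using h.length_le_dist hδ hhyp _ (isReduced_replicate p n)

lemma le_gromovProd_pow (h : IsSchottky δ A o φ) (hδ : 0 ≤ δ) (hhyp : IsGromovHyperbolic X δ)
    (p : α × Bool) (n : ℕ) :
    A + 2 * δ + 1 ≤ gromovProd o (letterVal φ p • o) (letterVal φ p ^ (n + 1) • o) := by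
  have h1 := h.reduced_word hδ hhyp p (List.replicate n p) (isReduced_replicate p (n + 1))
  have h2 := h.le_dist_letterVal p
  rw [List.map_replicate, List.prod_replicate] at h1
  rw [pow_succ', gromovProd_mul_smul]
  linarith

lemma gromovProd_pow_le (h : IsSchottky δ A o φ) (hδ : 0 ≤ δ) (hhyp : IsGromovHyperbolic X δ)
    {p q : α × Bool} (hpq : p ≠ q) (n m : ℕ) :
    gromovProd o (letterVal φ p ^ n • o) (letterVal φ q ^ m • o) ≤ A + 2 * δ := by
  have hz (x : X) : gromovProd o o x = 0 := by simp [gromovProd]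
  have hA := h.nonneg
  rcases n with _ | n
  · rw [pow_zero, one_smul, hz]
    linarith
  rcases m with _ | m
  · rw [pow_zero, one_smul, gromovProd_comm, hz]
    linarith
  have h1 := h.le_gromovProd_pow hδ hhyp p n
  have h2 := h.le_gromovProd_pow hδ hhyp q m
  rw [gromovProd_comm] at h2
  have h3 := h.gromovProd_le p q hpq
  have h4 := hhyp o (letterVal φ p • o) (letterVal φ p ^ (n + 1) • o) (letterVal φ q • o)
  have h5 := hhyp o (letterVal φ p ^ (n + 1) • o) (letterVal φ q ^ (m + 1) • o) (letterVal φ q • o)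
  by_contra! hlt
  have h6 : A + δ < gromovProd o (letterVal φ p ^ (n + 1) • o) (letterVal φ q • o) := by
    have := lt_min hlt ((lt_add_one _).trans_le h2)
    linarith
  have h7 := lt_min ((show A + δ < A + 2 * δ + 1 by linarith).trans_le h1) h6
  linarith

lemma gromovSeq_pow (h : IsSchottky δ A o φ) (hδ : 0 ≤ δ) (hhyp : IsGromovHyperbolic X δ)
    (p : α × Bool) : GromovSeq fun n => letterVal φ p ^ n • o := by
  have key (n k : ℕ) : (n : ℝ) - (A + 2 * δ) ≤
      gromovProd o (letterVal φ p ^ n • o) (letterVal φ p ^ (n + k) • o) := by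
    have h1 := h.le_dist_pow hδ hhyp p n
    have h2 := h.gromovProd_pow_le hδ hhyp (p := (p.1, !p.2)) (q := p)
      (fun e => by simpa using congrArg Prod.snd e) n k
    rw [letterVal_not, inv_pow] at h2
    rw [pow_add, gromovProd_mul_smul]
    linarith
  suffices Tendsto (fun r : ℕ × ℕ =>
      gromovProd o (letterVal φ p ^ r.1 • o) (letterVal φ p ^ r.2 • o)) atTop atTop from
    fun o' => tendsto_gromovProd_basepoint (u := fun n => letterVal φ p ^ n • o)
      (v := fun n => letterVal φ p ^ n • o) o' this
  refine (tendsto_gromovProd_iff o (fun n => letterVal φ p ^ n • o)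
    (fun n => letterVal φ p ^ n • o)).2 fun R => ?_
  obtain ⟨N, hN⟩ := exists_nat_ge (R + (A + 2 * δ))
  refine ⟨N, fun n hn m hm => ?_⟩
  have hn' : (N : ℝ) ≤ n := by exact_mod_cast hn
  have hm' : (N : ℝ) ≤ m := by exact_mod_cast hm
  rcases le_total n m with hnm | hnm
  · obtain ⟨k, rfl⟩ := Nat.exists_eq_add_of_le hnm
    linarith [key n k]
  · obtain ⟨k, rfl⟩ := Nat.exists_eq_add_of_le hnm
    rw [gromovProd_comm]
    linarith [key m k]

lemma not_gromovEquiv_pow (h : IsSchottky δ A o φ) (hδ : 0 ≤ δ) (hhyp : IsGromovHyperbolic X δ)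
    {p q : α × Bool} (hpq : p ≠ q) (x : X) :
    ¬ GromovEquiv (fun n => letterVal φ p ^ n • x) fun n => letterVal φ q ^ n • x := by
  intro he
  have h1 : Tendsto (fun r : ℕ × ℕ =>
      gromovProd o (letterVal φ p ^ r.1 • o) (letterVal φ q ^ r.2 • o)) atTop atTop :=
    tendsto_gromovProd_of_dist_le (u := fun n => letterVal φ p ^ n • x)
      (u' := fun n => letterVal φ p ^ n • o) (v := fun n => letterVal φ q ^ n • x)
      (v' := fun n => letterVal φ q ^ n • o) (C := dist x o) (D := dist x o) o (he.2.2 x)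
      (fun n => (dist_smul _ x o).le) (fun n => (dist_smul _ x o).le)
  obtain ⟨N, hN⟩ := (tendsto_gromovProd_iff o (fun n => letterVal φ p ^ n • o)
    (fun n => letterVal φ q ^ n • o)).1 h1 (A + 2 * δ + 1)
  linarith [hN N le_rfl N le_rfl, h.gromovProd_pow_le hδ hhyp hpq N N]

lemma loxodromic (h : IsSchottky δ A o φ) (hδ : 0 ≤ δ) (hhyp : IsGromovHyperbolic X δ) (a : α) :
    Loxodromic (X := X) (φ a) := by
  have hsub : Subadditive fun n : ℕ => dist o (φ a ^ n • o) := by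
    intro m n
    have := dist_triangle o (φ a ^ m • o) (φ a ^ (m + n) • o)
    simpa only [pow_add, mul_smul, dist_smul] using this
  have hbdd : BddBelow (Set.range fun n : ℕ => dist o (φ a ^ n • o) / n) :=
    ⟨0, by rintro _ ⟨n, rfl⟩; positivity⟩
  have hlim := hsub.tendsto_lim hbdd
  refine ⟨hsub.lim, ?_, fun x => ?_⟩
  · refine one_pos.trans_le (ge_of_tendsto hlim (eventually_atTop.2 ⟨1, fun n hn => ?_⟩))
    have hn' : (0 : ℝ) < n := by exact_mod_cast hn
    rw [le_div_iff₀ hn', one_mul]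
    exact h.le_dist_pow hδ hhyp (a, true) n
  · have hdiff : Tendsto (fun n : ℕ => (dist x (φ a ^ n • x) - dist o (φ a ^ n • o)) / n)
        atTop (nhds 0) := by
      refine squeeze_zero_norm (fun n => ?_)
        (tendsto_const_div_atTop_nhds_zero_nat (2 * dist x o))
      rw [norm_div, Real.norm_natCast, Real.norm_eq_abs]
      gcongr
      have := dist_dist_dist_le x (φ a ^ n • x) o (φ a ^ n • o)
      rw [Real.dist_eq, dist_smul] at this
      linarith
    refine (hlim.add hdiff).congr' (Eventually.of_forall fun n => ?_) |>.trans (by simp)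
    ring

end IsSchottky

end Schottky

section Main

variable {G X : Type*} [Group G] [MetricSpace X] [MulAction G X] [IsIsometricSMul G X] {δ : ℝ}

/-- If a limit point is not fixed, some element is in Schottky position by itself. -/
lemma exists_isSchottky_single (hhyp : IsGromovHyperbolic X δ) {o : X} {w : ℕ → G}
    (hw : GromovSeq fun n => w n • o) {g : G}
    (hg : ¬ GromovEquiv (fun n => g • w n • o) fun n => w n • o) :
    ∃ (A : ℝ) (u : G), IsSchottky δ A o fun _ : Unit => u := by
  obtain ⟨C, hC⟩ := exists_gromovProd_le_of_not_equiv hhyp (hw.smul g) hw hg o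
  set D := dist o (g • o)
  set A : ℝ := max 0 (C + δ + D)
  have hA : C + δ + D ≤ A := le_max_right _ _
  have hD : 0 ≤ D := dist_nonneg
  obtain ⟨n, hn1, hn2⟩ := (hC.and
    ((hw.tendsto_dist o).eventually_ge_atTop (2 * A + 3 * δ + 1 + D))).exists
  have single (u : G) (h1 : gromovProd o (u • o) (u⁻¹ • o) ≤ A)
      (h2 : 2 * A + 3 * δ + 1 ≤ dist o (u • o)) : IsSchottky δ A o fun _ : Unit => u := by
    refine ⟨le_max_left _ _, ?_, fun _ => h2⟩
    rintro ⟨_, _ | _⟩ ⟨_, _ | _⟩ hpq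
    · exact absurd rfl hpq
    · simpa [letterVal, gromovProd_comm] using h1
    · simpa [letterVal] using h1
    · exact absurd rfl hpq
  have h3 := hhyp o (g • w n • o) ((w n)⁻¹ • o) (w n • o)
  rcases min_le_iff.1 (sub_le_iff_le_add.1 h3) with h | h
  · refine ⟨A, g * w n, single _ ?_ ?_⟩
    · have e := gromovProd_le_add o o ((g * w n) • o) (g • w n • o)
        ((g * w n)⁻¹ • o) ((w n)⁻¹ • o)
      rw [mul_inv_rev, mul_smul, mul_smul, dist_self, dist_self, dist_smul, dist_comm (g⁻¹ • o),
        dist_inv_smul_self] at e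
      rw [mul_inv_rev, mul_smul, mul_smul]
      linarith
    · have e := dist_triangle_left (g • o) ((g * w n) • o) o
      have e' : dist (g • o) ((g * w n) • o) = dist o (w n • o) := by
        rw [mul_smul, dist_smul]
      linarith
  · refine ⟨A, w n, single _ ?_ (by linarith)⟩
    rw [gromovProd_comm]
    linarith

/-- Without finite orbits on the boundary, a single element in Schottky position yields a pair. -/
lemma exists_isSchottky_pair (hδ : 0 ≤ δ) (hhyp : IsGromovHyperbolic X δ)
    (hnofin : ¬ ∃ (k : ℕ) (u : Fin k → ℕ → X), 0 < k ∧ (∀ i, GromovSeq (u i)) ∧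
      ∀ (g : G) (i : Fin k), ∃ j : Fin k, GromovEquiv (fun n => g • u i n) (u j))
    {o : X} {A : ℝ} {u : G} (hu : IsSchottky δ A o fun _ : Unit => u) :
    ∃ (B : ℝ) (g h : G), IsSchottky δ B o fun b : Bool => if b then g else h := by
  have hU : GromovSeq fun n => u ^ n • o := hu.gromovSeq_pow hδ hhyp ((), true)
  have hV : GromovSeq fun n => u⁻¹ ^ n • o := hu.gromovSeq_pow hδ hhyp ((), false)
  set U : ℕ → X := fun n => u ^ n • o
  set V : ℕ → X := fun n => u⁻¹ ^ n • o
  obtain ⟨a, ha⟩ := exists_smul_not_gromovEquiv hhyp hnofin hV ![U]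
  obtain ⟨b, hb⟩ := exists_smul_not_gromovEquiv hhyp hnofin hU ![U, fun n => a • V n]
  obtain ⟨c, hc⟩ := exists_smul_not_gromovEquiv hhyp hnofin hV
    ![U, fun n => a • V n, fun n => b • U n]
  have ha0 := ha 0
  have hb0 := hb 0
  have hb1 := hb 1
  have hc0 := hc 0
  have hc1 := hc 1
  have hc2 := hc 2
  simp only [Matrix.cons_val] at ha0 hb0 hb1 hc0 hc1 hc2
  let z : Bool × Bool → ℕ → X := fun p =>
    cond p.1 (cond p.2 U fun n => a • V n) (cond p.2 (fun n => b • U n) fun n => c • V n)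
  let φ : ℕ → Bool → G := fun n t => if t then u ^ n * a⁻¹ else b * u ^ n * c⁻¹
  suffices H : ∃ (B : ℝ) (n : ℕ), IsSchottky δ B o (φ n) by
    obtain ⟨B, n, h⟩ := H
    exact ⟨B, _, _, h⟩
  refine exists_isSchottky hhyp o φ z ?_ ?_
    (dist o (a • o) + dist o (b • o) + dist o (c • o)) ?_
  · rintro ⟨_ | _, _ | _⟩
    exacts [hV.smul c, hU.smul b, hV.smul a, hU]
  · rintro ⟨_ | _, _ | _⟩ ⟨_ | _, _ | _⟩ hpq
    exacts [absurd rfl hpq, hc2, hc1, hc0, fun e => hc2 e.symm, absurd rfl hpq, hb1, hb0,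
      fun e => hc1 e.symm, fun e => hb1 e.symm, absurd rfl hpq, ha0,
      fun e => hc0 e.symm, fun e => hb0 e.symm, fun e => ha0 e.symm, absurd rfl hpq]
  · have e (k : G) : dist (k⁻¹ • o) o = dist o (k • o) := by rw [dist_comm, dist_inv_smul_self]
    have e1 : 0 ≤ dist o (a • o) := dist_nonneg
    have e2 : 0 ≤ dist o (b • o) := dist_nonneg
    have e3 : 0 ≤ dist o (c • o) := dist_nonneg
    rintro n ⟨_ | _, _ | _⟩ <;>
      simp [z, φ, U, V, letterVal, mul_smul, e] <;> linarith

end Main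

/-- Let X be a δ-hyperbolic geodesic metric space and G a group acting on X by
isometries. If the limit set of G in the Gromov boundary ∂X is nonempty and G has no finite
orbit in ∂X, then G contains two loxodromic isometries with disjoint fixed-point pairs that
generate a free subgroup of rank two. (Boundary points are represented by Gromov sequences.) -/
theorem stmt9 {G X : Type*} [Group G] [MulAction G X] [MetricSpace X]
    (δ : ℝ) (hδ : 0 ≤ δ) (hgeo : IsGeodesicSpace X) (hhyp : IsGromovHyperbolic X δ)
    (hiso : ∀ g : G, Isometry (fun x : X => g • x))
    (hlim : ∃ (x : X) (w : ℕ → G), GromovSeq (fun n => w n • x))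
    (hnofin : ¬ ∃ (k : ℕ) (u : Fin k → ℕ → X), 0 < k ∧ (∀ i, GromovSeq (u i)) ∧
      ∀ (g : G) (i : Fin k), ∃ j : Fin k, GromovEquiv (fun n => g • u i n) (u j)) :
    ∃ g h : G, Loxodromic (X := X) g ∧ Loxodromic (X := X) h ∧
      (∀ x : X, ∀ a ∈ ({g, g⁻¹} : Set G), ∀ b ∈ ({h, h⁻¹} : Set G),
        ¬ GromovEquiv (fun n => (a ^ n) • x) (fun n => (b ^ n) • x)) ∧
      Function.Injective (FreeGroup.lift fun b : Bool => if b then g else h) := by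
  have : IsIsometricSMul G X := ⟨hiso⟩
  obtain ⟨o, w, hw⟩ := hlim
  obtain ⟨f, hf⟩ := exists_smul_not_gromovEquiv hhyp hnofin hw ![fun n => w n • o]
  obtain ⟨A, u, hu⟩ := exists_isSchottky_single hhyp hw (hf 0)
  obtain ⟨B, g, h, hgh⟩ := exists_isSchottky_pair hδ hhyp hnofin hu
  refine ⟨g, h, hgh.loxodromic hδ hhyp true, hgh.loxodromic hδ hhyp false, ?_,
    hgh.lift_injective hδ hhyp⟩
  have hne (s t : Bool) : ((true, s) : Bool × Bool) ≠ (false, t) := by simp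
  rintro x a (rfl | rfl) b (rfl | rfl)
  exacts [hgh.not_gromovEquiv_pow hδ hhyp (hne true true) x,
    hgh.not_gromovEquiv_pow hδ hhyp (hne true false) x,
    hgh.not_gromovEquiv_pow hδ hhyp (hne false true) x,
    hgh.not_gromovEquiv_pow hδ hhyp (hne false false) x]
end

section
/- Let T be a minimal simplicial F_N-tree with at most cyclic edge stabilizers (N ≥ 2). Then every edge stabilizer of T is contained in a proper free factor of F_N, and there is at most one conjugacy class of vertex stabilizers of T that is not contained in any proper free factor of F_N. -/
/-- A subgroup A of a group G is a free factor if G splits as an (internal) free product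
G = A * B for some subgroup B, i.e. the natural map A ∗ B → G is an isomorphism. -/
def IsFreeFactor {G : Type*} [Group G] (A : Subgroup G) : Prop :=
  ∃ B : Subgroup G, Function.Bijective (Monoid.Coprod.lift A.subtype B.subtype)

section Splits

variable {G : Type*}

/-- `A` splits `Y` if both `A` and its complement contain infinitely many elements of `Y`. -/
def Splits (A Y : Set G) : Prop := (Y ∩ A).Infinite ∧ (Y \ A).Infinite

theorem not_splits {A Y : Set G} : ¬Splits A Y ↔ (Y ∩ A).Finite ∨ (Y \ A).Finite := by
  simp only [Splits, Set.Infinite]; tauto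

theorem Splits.mono {A Y Z : Set G} (h : Splits A Y) (hYZ : Y ⊆ Z) : Splits A Z :=
  ⟨h.1.mono (Set.inter_subset_inter_left _ hYZ), h.2.mono (Set.sdiff_subset_sdiff_left hYZ)⟩

theorem splits_compl {A Y : Set G} : Splits Aᶜ Y ↔ Splits A Y := by
  simp only [Splits, ← Set.sdiff_eq, Set.sdiff_compl]; tauto

theorem splits_of_almost_eq {A B Y D : Set G} (hD : D.Finite)
    (h : ∀ g ∈ Y, g ∉ D → (g ∈ A ↔ g ∈ B)) (hA : Splits A Y) : Splits B Y := by
  constructor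
  · intro hf
    refine hA.1 ((hf.union hD).subset fun g hg => ?_)
    by_cases hgD : g ∈ D
    · exact Or.inr hgD
    · exact Or.inl ⟨hg.1, (h g hg.1 hgD).1 hg.2⟩
  · intro hf
    refine hA.2 ((hf.union hD).subset fun g hg => ?_)
    by_cases hgD : g ∈ D
    · exact Or.inr hgD
    · exact Or.inl ⟨hg.1, fun hb => hg.2 ((h g hg.1 hgD).2 hb)⟩

theorem splits_congr {A B Y D : Set G} (hD : D.Finite)
    (h : ∀ g ∈ Y, g ∉ D → (g ∈ A ↔ g ∈ B)) : Splits A Y ↔ Splits B Y :=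
  ⟨splits_of_almost_eq hD h, splits_of_almost_eq hD fun g hg hgD => (h g hg hgD).symm⟩

theorem not_splits_union {A B Y : Set G} (hA : ¬Splits A Y) (hB : ¬Splits B Y) :
    ¬Splits (A ∪ B) Y := by
  rw [not_splits] at *
  rcases hA with hA | hA
  · rcases hB with hB | hB
    · left; rw [Set.inter_union_distrib_left]; exact hA.union hB
    · right; exact hB.subset (Set.sdiff_subset_sdiff_right Set.subset_union_right)
  · right; exact hA.subset (Set.sdiff_subset_sdiff_right Set.subset_union_left)

theorem not_splits_xor {A B Y : Set G} (hA : ¬Splits A Y) (hB : ¬Splits B Y) :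
    ¬Splits {g | ¬(g ∈ A ↔ g ∈ B)} Y := by
  have key : ∀ {A B : Set G}, ¬Splits A Y → (Y ∩ B).Finite → ¬Splits {g | ¬(g ∈ A ↔ g ∈ B)} Y := by
    intro A B hA hB h
    exact hA (splits_of_almost_eq hB (fun g hg hgD => by
      have : g ∉ B := fun h => hgD ⟨hg, h⟩
      simp [this]) h)
  rcases not_splits.1 hB with hB' | hB'
  · exact key hA hB'
  · have h1 := key (B := Bᶜ) hA (by rwa [← Set.sdiff_eq])
    rw [← splits_compl]
    convert h1 using 2
    ext g
    simp only [Set.mem_compl_iff, Set.mem_ofPred_eq]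
    tauto

theorem splits_preimage {G' : Type*} (e : G ≃ G') {A Y : Set G'} :
    Splits (e ⁻¹' A) (e ⁻¹' Y) ↔ Splits A Y := by
  have h : ∀ Z : Set G', (e ⁻¹' Z).Infinite ↔ Z.Infinite := fun Z =>
    not_congr ⟨fun h => h.of_preimage e.surjective, fun h => h.preimage e.injective.injOn⟩
  rw [Splits, Splits, ← Set.preimage_inter, ← Set.preimage_sdiff, h, h]

end Splits

section AlmostInvariant

variable {G : Type*} [Group G]

/-- The elements at which membership in `A` changes under right multiplication by `s`. -/
def rightBoundary (A : Set G) (s : G) : Set G := {g | ¬(g ∈ A ↔ g * s ∈ A)}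

/-- A subset of a group is almost invariant if every right translate differs from it by a
finite set. -/
def AlmostInvariant (A : Set G) : Prop := ∀ s, (rightBoundary A s).Finite

/-- The left coset `xH`. -/
def cosetOf (x : G) (H : Subgroup G) : Set G := {g | x⁻¹ * g ∈ H}

/-- The left cosets of `H` that are split by `A`. -/
def splitCosets (A : Set G) (H : Subgroup G) : Set (Set G) :=
  {Y | (∃ x, Y = cosetOf x H) ∧ Splits A Y}

theorem mem_rightBoundary {A : Set G} {s g : G} :
    g ∈ rightBoundary A s ↔ ¬(g ∈ A ↔ g * s ∈ A) := Iff.rfl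

theorem mem_cosetOf {x g : G} {H : Subgroup G} : g ∈ cosetOf x H ↔ x⁻¹ * g ∈ H := Iff.rfl

theorem self_mem_cosetOf (x : G) (H : Subgroup G) : x ∈ cosetOf x H := by
  simp [mem_cosetOf]

theorem cosetOf_eq {x g : G} {H : Subgroup G} (h : g ∈ cosetOf x H) :
    cosetOf g H = cosetOf x H := by
  ext k
  rw [mem_cosetOf] at *
  rw [mem_cosetOf, ← H.mul_mem_cancel_left h]
  simp [mul_assoc]

theorem AlmostInvariant.splits_mul_right {A Y : Set G} (hA : AlmostInvariant A) (k : G) :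
    Splits A {g | g * k ∈ Y} ↔ Splits A Y := by
  refine (splits_congr (hA k) fun g _ hg => ?_).trans (splits_preimage (Equiv.mulRight k))
  exact not_not.1 hg

theorem AlmostInvariant.compl {A : Set G} (hA : AlmostInvariant A) : AlmostInvariant Aᶜ :=
  fun s => (hA s).subset fun g hg => by
    simp only [mem_rightBoundary, Set.mem_compl_iff] at *; tauto

theorem AlmostInvariant.xor {A B : Set G} (hA : AlmostInvariant A) (hB : AlmostInvariant B) :
    AlmostInvariant {g | ¬(g ∈ A ↔ g ∈ B)} :=
  fun s => ((hA s).union (hB s)).subset fun g hg => by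
    simp only [mem_rightBoundary, Set.mem_union, Set.mem_ofPred_eq] at *; tauto

theorem AlmostInvariant.preimage_mul_left {A : Set G} (hA : AlmostInvariant A) (k : G) :
    AlmostInvariant {g | k * g ∈ A} := fun s =>
  ((hA s).preimage (f := fun g => k * g) (mul_right_injective k).injOn).subset fun g hg => by
    simp only [mem_rightBoundary, Set.mem_preimage, Set.mem_ofPred_eq, mul_assoc] at *; exact hg

theorem AlmostInvariant.preimage {G' : Type*} [Group G'] (e : G ≃* G') {A : Set G'}
    (hA : AlmostInvariant A) : AlmostInvariant (e ⁻¹' A) := fun s =>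
  ((hA (e s)).preimage (f := e) e.injective.injOn).subset fun g hg => by
    simpa only [mem_rightBoundary, Set.mem_preimage, map_mul] using hg

theorem almostInvariant_of_closure {S : Set G} (hS : Subgroup.closure S = ⊤) {A : Set G}
    (h : ∀ s ∈ S, (rightBoundary A s).Finite) : AlmostInvariant A := by
  intro s
  have hs : s ∈ Subgroup.closure S := hS ▸ Subgroup.mem_top s
  induction hs using Subgroup.closure_induction with
  | mem x hx => exact h x hx
  | one => simp [rightBoundary]
  | mul x y _ _ hx hy =>
    refine (hx.union (hy.preimage (f := fun g => g * x) (mul_left_injective x).injOn)).subset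
      fun g hg => ?_
    simp only [mem_rightBoundary, Set.mem_preimage, Set.mem_union, ← mul_assoc] at *
    tauto
  | inv x _ hx =>
    refine (hx.preimage (f := fun g => g * x⁻¹) (mul_left_injective _).injOn).subset fun g hg => ?_
    simp only [mem_rightBoundary, Set.mem_preimage, inv_mul_cancel_right] at *
    tauto

theorem eq_or_eq_compl_of_rightBoundary {S : Set G} (hS : Subgroup.closure S = ⊤) {A B : Set G}
    (h : ∀ s ∈ S, ∀ g, g ∈ rightBoundary A s ↔ g ∈ rightBoundary B s) : A = B ∨ A = Bᶜ := by
  have key : ∀ s g : G, (g ∈ A ↔ g ∈ B) ↔ (g * s ∈ A ↔ g * s ∈ B) := by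
    intro s
    have hs : s ∈ Subgroup.closure S := hS ▸ Subgroup.mem_top s
    induction hs using Subgroup.closure_induction with
    | mem x hx =>
      intro g
      have := h x hx g
      simp only [mem_rightBoundary] at this
      tauto
    | one => simp
    | mul x y _ _ hx hy => intro g; rw [hx g, hy (g * x), mul_assoc]
    | inv x _ hx => intro g; rw [hx (g * x⁻¹), inv_mul_cancel_right]
  by_cases h1 : (1 : G) ∈ A ↔ (1 : G) ∈ B
  · left; ext g; simpa using (key g 1).1 h1
  · right; ext g
    have := (not_congr (key g 1)).1 h1
    simp only [one_mul, Set.mem_compl_iff] at *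
    tauto

theorem splitCosets_eq_empty {A : Set G} {H : Subgroup G} :
    splitCosets A H = ∅ ↔ ∀ x, ¬Splits A (cosetOf x H) := by
  rw [Set.eq_empty_iff_forall_notMem]
  constructor
  · exact fun h x hx => h _ ⟨⟨x, rfl⟩, hx⟩
  · rintro h _ ⟨⟨x, rfl⟩, hx⟩
    exact h x hx

theorem splitCosets_compl (A : Set G) (H : Subgroup G) : splitCosets Aᶜ H = splitCosets A H := by
  simp only [splitCosets, splits_compl]

theorem splitCosets_preimage {G' : Type*} [Group G'] (e : G ≃* G') (A : Set G')
    (H : Subgroup G') : splitCosets (e ⁻¹' A) (H.comap e.toMonoidHom) =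
      (fun Y => e ⁻¹' Y) '' splitCosets A H := by
  have hc : ∀ x : G, cosetOf x (H.comap e.toMonoidHom) = e ⁻¹' cosetOf (e x) H := by
    intro x; ext g; simp [mem_cosetOf]
  ext Y
  constructor
  · rintro ⟨⟨x, rfl⟩, h⟩
    rw [hc] at h ⊢
    exact ⟨_, ⟨⟨e x, rfl⟩, (splits_preimage e.toEquiv).1 h⟩, rfl⟩
  · rintro ⟨_, ⟨⟨x, rfl⟩, h⟩, rfl⟩
    refine ⟨⟨e.symm x, ?_⟩, (splits_preimage e.toEquiv).2 h⟩
    ext g; simp [mem_cosetOf]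

theorem ncard_splitCosets_preimage {G' : Type*} [Group G'] (e : G ≃* G') (A : Set G')
    (H : Subgroup G') :
    (splitCosets (e ⁻¹' A) (H.comap e.toMonoidHom)).ncard = (splitCosets A H).ncard := by
  rw [splitCosets_preimage]
  exact Set.ncard_image_of_injective _ e.surjective.preimage_injective

theorem splitCosets_preimage_mul_left (k : G) (A : Set G) (H : Subgroup G) :
    splitCosets {g | k * g ∈ A} H = (fun Y => {g | k * g ∈ Y}) '' splitCosets A H := by
  have hs : ∀ Y, Splits {g | k * g ∈ A} {g | k * g ∈ Y} ↔ Splits A Y := fun Y =>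
    splits_preimage (Equiv.mulLeft k)
  ext Y
  constructor
  · rintro ⟨⟨x, rfl⟩, h⟩
    refine ⟨cosetOf (k * x) H, ⟨⟨_, rfl⟩, ?_⟩, ?_⟩
    · rw [← hs]; convert h using 2; ext g; simp [mem_cosetOf, mul_assoc]
    · ext g; simp [mem_cosetOf, mul_assoc]
  · rintro ⟨_, ⟨⟨x, rfl⟩, h⟩, rfl⟩
    refine ⟨⟨k⁻¹ * x, ?_⟩, (hs _).2 h⟩
    ext g; simp [mem_cosetOf, mul_assoc]

theorem ncard_splitCosets_preimage_mul_left (k : G) (A : Set G) (H : Subgroup G) :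
    (splitCosets {g | k * g ∈ A} H).ncard = (splitCosets A H).ncard := by
  rw [splitCosets_preimage_mul_left]
  exact Set.ncard_image_of_injective _ (Equiv.mulLeft k).surjective.preimage_injective

end AlmostInvariant

namespace FreeGroup

section Letters

variable {α : Type*}

/-- The formal inverse of a letter. -/
def letterInv (d : α × Bool) : α × Bool := (d.1, !d.2)

theorem letterInv_letterInv (d : α × Bool) : letterInv (letterInv d) = d := by
  simp [letterInv]

theorem letterInv_ne (d : α × Bool) : letterInv d ≠ d := fun h => by
  have := congrArg Prod.snd h
  simp [letterInv] at this

theorem inv_letter (d : α × Bool) : (mk [d])⁻¹ = mk [letterInv d] := rfl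

variable [DecidableEq α]

theorem toWord_letter (d : α × Bool) : (mk [d]).toWord = [d] := rfl

theorem toWord_mk_of_isReduced {L : List (α × Bool)} (h : IsReduced L) : (mk L).toWord = L := by
  rw [toWord_mk, h.reduce_eq]

theorem toWord_mul_letter (x : FreeGroup α) (d : α × Bool) :
    (∃ L, x.toWord = L ++ [letterInv d] ∧ (x * mk [d]).toWord = L) ∨
      ((x * mk [d]).toWord = x.toWord ++ [d] ∧ x.toWord.getLast? ≠ some (letterInv d)) := by
  have hx : IsReduced x.toWord := isReduced_toWord
  have hmk : x = mk x.toWord := mk_toWord.symm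
  rcases List.eq_nil_or_concat x.toWord with h | ⟨L, e, h⟩
  · right
    rw [toWord_eq_nil_iff] at h
    simp [h]
  · rw [List.concat_eq_append] at h
    by_cases he : e = letterInv d
    · left
      subst he
      refine ⟨L, h, ?_⟩
      have h1 : x * mk [d] = mk L := by
        conv_lhs => rw [hmk, h, ← mul_mk, ← inv_letter, inv_mul_cancel_right]
      rw [h1]
      exact toWord_mk_of_isReduced (List.IsChain.left_of_append (h ▸ hx))
    · right
      refine ⟨?_, by simpa [h] using he⟩
      have h1 : x * mk [d] = mk (x.toWord ++ [d]) := by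
        conv_lhs => rw [hmk, mul_mk]
      rw [h1]
      apply toWord_mk_of_isReduced
      unfold IsReduced at hx ⊢
      rw [List.isChain_append]
      refine ⟨hx, by simp, ?_⟩
      simp only [h, List.getLast?_append, List.getLast?_singleton, List.head?_singleton]
      rintro _ ⟨⟩ _ ⟨⟩ h1
      by_contra h2
      apply he
      ext
      · exact h1
      · simp only [letterInv]
        revert h2; cases e.2 <;> cases d.2 <;> simp

/-- The elements whose reduced word starts with a letter in `U`. -/
def cone (U : Set (α × Bool)) : Set (FreeGroup α) := {g | ∃ d ∈ U, g.toWord.head? = some d}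

theorem mem_cone {U : Set (α × Bool)} {g : FreeGroup α} :
    g ∈ cone U ↔ ∃ d ∈ U, g.toWord.head? = some d := Iff.rfl

theorem mem_cone_of_head? {U : Set (α × Bool)} {g : FreeGroup α} {d : α × Bool}
    (h : g.toWord.head? = some d) : g ∈ cone U ↔ d ∈ U := by
  simp [mem_cone, h]

theorem one_notMem_cone (U : Set (α × Bool)) : (1 : FreeGroup α) ∉ cone U := by
  simp [mem_cone]

theorem mul_letter_mem_cone (U : Set (α × Bool)) (d : α × Bool) (g : FreeGroup α) :
    (g * mk [d] ∈ cone U) ↔ ¬(g ∈ cone U ↔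
      ((g = 1 ∧ d ∈ U) ∨ (g = mk [letterInv d] ∧ letterInv d ∈ U))) := by
  rcases toWord_mul_letter g d with ⟨L, h1, h2⟩ | ⟨h1, h2⟩
  · have hg : g ≠ 1 := by rintro rfl; simp at h1
    rcases L with _ | ⟨e, L⟩
    · rw [toWord_eq_nil_iff] at h2
      have hg' : g = mk [letterInv d] := by rw [← mk_toWord (x := g), h1]; rfl
      have h3 : g ∈ cone U ↔ letterInv d ∈ U := mem_cone_of_head? (by rw [h1]; rfl)
      have := one_notMem_cone U
      rw [h2, h3]
      tauto
    · have hg' : g ≠ mk [letterInv d] := by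
        rintro rfl; simp at h1
      rw [mem_cone_of_head? (d := e) (by rw [h2]; rfl), mem_cone_of_head? (d := e) (by rw [h1]; rfl)]
      tauto
  · have hg' : g ≠ mk [letterInv d] := by rintro rfl; exact h2 rfl
    rcases hL : g.toWord with _ | ⟨e, L⟩
    · rw [mem_cone_of_head? (d := d) (by rw [h1, hL]; rfl)]
      rw [toWord_eq_nil_iff] at hL
      subst hL
      have := one_notMem_cone U
      tauto
    · have hg : g ≠ 1 := by rintro rfl; simp at hL
      rw [mem_cone_of_head? (d := e) (by rw [h1, hL]; rfl),
        mem_cone_of_head? (d := e) (by rw [hL]; rfl)]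
      tauto

theorem mem_rightBoundary_cone_letter {U : Set (α × Bool)} {d : α × Bool} {g : FreeGroup α} :
    g ∈ rightBoundary (cone U) (mk [d]) ↔
      (g = 1 ∧ d ∈ U) ∨ (g = mk [letterInv d] ∧ letterInv d ∈ U) := by
  rw [mem_rightBoundary, mul_letter_mem_cone]
  tauto

theorem almostInvariant_cone (U : Set (α × Bool)) : AlmostInvariant (cone U) := by
  refine almostInvariant_of_closure (closure_range_of α) ?_
  rintro _ ⟨i, rfl⟩
  refine (Set.toFinite {1, mk [letterInv (i, true)]}).subset fun g hg => ?_
  rw [of, mem_rightBoundary_cone_letter] at hg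
  simp only [Set.mem_insert_iff, Set.mem_singleton_iff]
  tauto

theorem translate_cone_letterInv (d : α × Bool) :
    {g | mk [d] * g ∈ cone {d}} = cone {letterInv d} ∨
      {g | mk [d] * g ∈ cone {d}} = (cone {letterInv d})ᶜ := by
  refine eq_or_eq_compl_of_rightBoundary (closure_range_of α) ?_
  rintro _ ⟨i, rfl⟩ g
  have h1 : g ∈ rightBoundary {g | mk [d] * g ∈ cone {d}} (of i) ↔
      mk [d] * g ∈ rightBoundary (cone {d}) (of i) := by
    simp only [mem_rightBoundary, Set.mem_ofPred_eq, mul_assoc]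
  rw [h1, of, mem_rightBoundary_cone_letter, mem_rightBoundary_cone_letter,
    mul_eq_one_iff_eq_inv', inv_letter, ← eq_inv_mul_iff_mul_eq, inv_letter]
  rcases d with ⟨j, b⟩
  by_cases hij : i = j
  · subst hij
    rcases b with _ | _
    · have h2 : mk [(i, true), (i, false)] = 1 := mul_inv_cancel (of i)
      simp [letterInv, mul_mk, h2]
    · simp [letterInv, mul_mk]
  · simp [letterInv, hij]

theorem ncard_splitCosets_cone_letterInv (d : α × Bool) (H : Subgroup (FreeGroup α)) :
    (splitCosets (cone {letterInv d}) H).ncard = (splitCosets (cone {d}) H).ncard := by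
  rw [← ncard_splitCosets_preimage_mul_left (mk [d]) (cone {d})]
  rcases translate_cone_letterInv d with h | h <;> rw [h]
  rw [splitCosets_compl]

theorem splitCosets_cone_letterInv_eq_empty {d : α × Bool} {H : Subgroup (FreeGroup α)}
    (h : splitCosets (cone {d}) H = ∅) : splitCosets (cone {letterInv d}) H = ∅ := by
  have h1 := splitCosets_preimage_mul_left (mk [d]) (cone {d}) H
  rw [h, Set.image_empty] at h1
  rcases translate_cone_letterInv d with h2 | h2 <;> rw [h2] at h1
  · exact h1
  · rwa [splitCosets_compl] at h1

end Letters

section Whitehead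

variable {α : Type*}

open Classical in
/-- The endomorphism fixing the basis element `i₀` and multiplying each other letter of `U`
by `x`. -/
noncomputable def whiteheadHom (i₀ : α) (U : Set (α × Bool)) (x : FreeGroup α) :
    FreeGroup α →* FreeGroup α :=
  lift fun i => if i = i₀ then of i₀ else
    (if (i, true) ∈ U then x⁻¹ else 1) * of i * (if (i, false) ∈ U then x else 1)

theorem whiteheadHom_letter (i₀ : α) (U : Set (α × Bool)) (x : FreeGroup α) (b : Bool) :
    whiteheadHom i₀ U x (mk [(i₀, b)]) = mk [(i₀, b)] := by
  have h : whiteheadHom i₀ U x (of i₀) = of i₀ := by simp [whiteheadHom]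
  cases b
  · have h' : mk [(i₀, false)] = (of i₀)⁻¹ := rfl
    rw [h', _root_.map_inv, h]
  · exact h

theorem whiteheadHom_comp (i₀ : α) (U : Set (α × Bool)) {x y : FreeGroup α} (hxy : x * y = 1)
    (h : whiteheadHom i₀ U x y = y) :
    (whiteheadHom i₀ U x).comp (whiteheadHom i₀ U y) = MonoidHom.id _ := by
  classical
  obtain rfl : x = y⁻¹ := eq_inv_of_mul_eq_one_left hxy
  refine ext_hom _ _ fun i => ?_
  by_cases hi : i = i₀
  · subst hi; simp [whiteheadHom]
  · have h1 : whiteheadHom i₀ U y⁻¹ (of i) =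
      (if (i, true) ∈ U then y else 1) * of i * (if (i, false) ∈ U then y⁻¹ else 1) := by
      simp [whiteheadHom, hi]
    have h2 : whiteheadHom i₀ U y (of i) =
      (if (i, true) ∈ U then y⁻¹ else 1) * of i * (if (i, false) ∈ U then y else 1) := by
      simp [whiteheadHom, hi]
    rw [MonoidHom.comp_apply, h2]
    simp only [_root_.map_mul, apply_ite (whiteheadHom i₀ U y⁻¹), _root_.map_inv, h, h1,
      _root_.map_one, MonoidHom.id_apply]
    split_ifs <;> simp [mul_assoc]

/-- The Whitehead automorphism with multiplier the letter `a` and set of letters `U`. -/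
noncomputable def whitehead (a : α × Bool) (U : Set (α × Bool)) : FreeGroup α ≃* FreeGroup α :=
  MonoidHom.toMulEquiv (whiteheadHom a.1 U (mk [a])) (whiteheadHom a.1 U (mk [letterInv a]))
    (whiteheadHom_comp _ _ (by rw [← inv_letter, inv_mul_cancel]) (whiteheadHom_letter _ _ _ _))
    (whiteheadHom_comp _ _ (by rw [← inv_letter, mul_inv_cancel]) (whiteheadHom_letter _ _ _ _))

theorem whitehead_letter (a : α × Bool) (U : Set (α × Bool)) (b : Bool) :
    whitehead a U (mk [(a.1, b)]) = mk [(a.1, b)] := whiteheadHom_letter _ _ _ _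

open Classical in
theorem whitehead_of {a : α × Bool} (U : Set (α × Bool)) {i : α} (hi : i ≠ a.1) :
    whitehead a U (of i) = (if (i, true) ∈ U then mk [letterInv a] else 1) * of i *
      (if (i, false) ∈ U then mk [a] else 1) := by
  simp [whitehead, whiteheadHom, hi, ← inv_letter]

theorem mem_rightBoundary_preimage {G G' : Type*} [Group G] [Group G'] (e : G ≃* G') (A : Set G')
    (s g : G) : g ∈ rightBoundary (e ⁻¹' A) s ↔ e g ∈ rightBoundary A (e s) := by
  simp [mem_rightBoundary]

variable [DecidableEq α]

theorem whitehead_preimage_cone {a : α × Bool} {U : Set (α × Bool)} (ha : a ∈ U)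
    (ha' : letterInv a ∉ U) : whitehead a U ⁻¹' cone U = cone {a} ∨
      whitehead a U ⁻¹' cone U = (cone {a})ᶜ := by
  classical
  refine eq_or_eq_compl_of_rightBoundary (closure_range_of α) ?_
  rintro _ ⟨i, rfl⟩ g
  rw [mem_rightBoundary_preimage]
  by_cases hi : i = a.1
  · subst hi
    have h1 : ∀ g, whitehead a U g = mk [(a.1, false)] ↔ g = mk [(a.1, false)] := fun g =>
      ⟨fun h => (whitehead a U).injective (by rw [h, whitehead_letter]),
        fun h => by rw [h, whitehead_letter]⟩
    have h2 : ∀ b, (a.1, b) ∈ U ↔ (a.1, b) = a := by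
      rintro b
      rcases a with ⟨i, c⟩
      cases b <;> cases c <;> simp_all [letterInv]
    rw [of, whitehead_letter, mem_rightBoundary_cone_letter, mem_rightBoundary_cone_letter]
    simp only [letterInv, Bool.not_true, h1, h2, Set.mem_singleton_iff, map_eq_one_iff _
      (whitehead a U).injective]
  · have h1 : ¬ g ∈ rightBoundary (cone {a}) (of i) := by
      rw [of, mem_rightBoundary_cone_letter]
      rintro (⟨-, h⟩ | ⟨-, h⟩) <;> exact hi (congrArg Prod.fst h)
    refine iff_of_false ?_ h1
    rw [whitehead_of U hi, mem_rightBoundary, not_not, ← mul_assoc, ← mul_assoc]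
    generalize whitehead a U g = x
    have key := mul_letter_mem_cone U
    set y := x * (if (i, true) ∈ U then mk [letterInv a] else 1) with hy
    set z := y * of i with hz
    set w := z * (if (i, false) ∈ U then mk [a] else 1) with hw
    have h1 : y ∈ cone U ↔ ¬(x ∈ cone U ↔ ((i, true) ∈ U ∧ y = 1)) := by
      by_cases h : (i, true) ∈ U
      · have e := key (letterInv a) x
        have e' : y = 1 ↔ x = mk [a] := by
          rw [hy, if_pos h, mul_eq_one_iff_eq_inv, inv_letter, letterInv_letterInv]
        rw [letterInv_letterInv] at e
        rw [e', hy, if_pos h]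
        tauto
      · simp [hy, h]
    have h2 : z ∈ cone U ↔ ¬(y ∈ cone U ↔ ((y = 1 ∧ (i, true) ∈ U) ∨ (z = 1 ∧ (i, false) ∈ U))) := by
      have e' : z = 1 ↔ y = mk [letterInv (i, true)] := by
        rw [hz, mul_eq_one_iff_eq_inv]; rfl
      rw [e']
      exact key (i, true) y
    have h3 : w ∈ cone U ↔ ¬(z ∈ cone U ↔ (z = 1 ∧ (i, false) ∈ U)) := by
      by_cases h : (i, false) ∈ U
      · rw [hw, if_pos h, key]
        tauto
      · simp [hw, h]
    have h4 : ¬(y = 1 ∧ z = 1) := by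
      rintro ⟨h, h'⟩
      rw [hz, h, one_mul] at h'
      exact of_ne_one i h'
    rw [h3, h2, h1]
    clear_value y z w
    clear h1 h2 h3 key hy hz hw
    by_cases hx : x ∈ cone U <;> by_cases hy : y = 1 <;> by_cases hz : z = 1 <;>
      by_cases e : (i, true) ∈ U <;> by_cases d : (i, false) ∈ U <;> simp_all

/-- Membership in the cone of a letter is not affected by multiplication by other letters. -/
theorem whitehead_preimage_cone_of_ne {a : α × Bool} {U : Set (α × Bool)} {j : α} (hj : j ≠ a.1) :
    ∃ k : FreeGroup α, whitehead a U ⁻¹' {g | k * g ∈ cone {(j, true)}} = cone {(j, true)} ∨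
      whitehead a U ⁻¹' {g | k * g ∈ cone {(j, true)}} = (cone {(j, true)})ᶜ := by
  classical
  set k : FreeGroup α := if (j, true) ∈ U then mk [a] else 1 with hk
  refine ⟨k, eq_or_eq_compl_of_rightBoundary (closure_range_of α) ?_⟩
  rintro _ ⟨i, rfl⟩ g
  rw [mem_rightBoundary_preimage]
  have hC : ∀ (d : α × Bool) (x : FreeGroup α), d.1 ≠ j →
      (x * mk [d] ∈ cone {(j, true)} ↔ x ∈ cone {(j, true)}) := by
    intro d x hd
    have h1 : d ∉ ({(j, true)} : Set (α × Bool)) := by rintro rfl; exact hd rfl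
    have h2 : letterInv d ∉ ({(j, true)} : Set (α × Bool)) := fun h => hd (congrArg Prod.fst h)
    rw [mul_letter_mem_cone]
    tauto
  by_cases hi : i = a.1
  · have hij : i ≠ j := by rw [hi]; exact hj.symm
    refine iff_of_false ?_ ?_
    · rw [hi, of, whitehead_letter, ← hi]
      simp only [mem_rightBoundary, Set.mem_ofPred_eq, ← mul_assoc]
      rw [hC _ _ hij]
      simp
    · rw [mem_rightBoundary, of, hC _ _ hij]
      simp
  · rw [whitehead_of U hi]
    simp only [mem_rightBoundary, Set.mem_ofPred_eq, ← mul_assoc]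
    have h3 : ∀ x : FreeGroup α, x * (if (i, false) ∈ U then mk [a] else 1) ∈ cone {(j, true)} ↔
        x ∈ cone {(j, true)} := by
      intro x
      split_ifs
      · exact hC _ _ hj.symm
      · rw [mul_one]
    have h4 : ∀ x : FreeGroup α, x * (if (i, true) ∈ U then mk [letterInv a] else 1) ∈
        cone {(j, true)} ↔ x ∈ cone {(j, true)} := by
      intro x
      split_ifs
      · exact hC _ _ hj.symm
      · rw [mul_one]
    rw [h3, ← h4 (k * whitehead a U g), ← mem_rightBoundary, ← mem_rightBoundary, of,
      mem_rightBoundary_cone_letter, mem_rightBoundary_cone_letter]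
    by_cases hij : i = j
    · subst hij
      have h5 : k * whitehead a U g * (if (i, true) ∈ U then mk [letterInv a] else 1) = 1 ↔
          g = 1 := by
        rw [hk]
        split_ifs
        · rw [← inv_letter, conj_eq_one_iff, map_eq_one_iff _ (whitehead a U).injective]
        · simp
      rw [h5]
      simp [letterInv]
    · simp [letterInv, hij]

/-- The total number of cosets of `H` split by the cones of the basis elements. -/
noncomputable def cosetComplexity [Fintype α] (H : Subgroup (FreeGroup α)) : ℕ :=
  ∑ i, (splitCosets (cone {(i, true)}) H).ncard

theorem ncard_splitCosets_cone_singleton (i : α) (b : Bool) (H : Subgroup (FreeGroup α)) :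
    (splitCosets (cone {(i, b)}) H).ncard = (splitCosets (cone {(i, true)}) H).ncard := by
  cases b
  · exact ncard_splitCosets_cone_letterInv (i, true) H
  · rfl

theorem ncard_splitCosets_whitehead {a : α × Bool} {U : Set (α × Bool)} (ha : a ∈ U)
    (ha' : letterInv a ∉ U) (H : Subgroup (FreeGroup α)) :
    (splitCosets (cone {a}) (H.comap (whitehead a U).toMonoidHom)).ncard =
      (splitCosets (cone U) H).ncard := by
  rw [← ncard_splitCosets_preimage (whitehead a U) _ H]
  rcases whitehead_preimage_cone ha ha' with h | h <;> rw [h]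
  rw [splitCosets_compl]

theorem cosetComplexity_whitehead_lt [Fintype α] {a : α × Bool} {U : Set (α × Bool)} (ha : a ∈ U)
    (ha' : letterInv a ∉ U) {H : Subgroup (FreeGroup α)}
    (h : (splitCosets (cone U) H).ncard < (splitCosets (cone {a}) H).ncard) :
    cosetComplexity (H.comap (whitehead a U).toMonoidHom) < cosetComplexity H := by
  refine Finset.sum_lt_sum (fun i _ => ?_) ⟨a.1, Finset.mem_univ _, ?_⟩
  · by_cases hi : i = a.1
    · rw [hi, ← ncard_splitCosets_cone_singleton _ a.2, ncard_splitCosets_whitehead ha ha',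
        ← ncard_splitCosets_cone_singleton a.1 a.2]
      exact h.le
    · obtain ⟨k, hk⟩ := whitehead_preimage_cone_of_ne (U := U) hi
      rw [← ncard_splitCosets_preimage_mul_left k (cone {(i, true)}) H,
        ← ncard_splitCosets_preimage (whitehead a U) _ H]
      rcases hk with hk | hk <;> rw [hk]
      rw [splitCosets_compl]
  · rw [← ncard_splitCosets_cone_singleton _ a.2, ncard_splitCosets_whitehead ha ha',
      ← ncard_splitCosets_cone_singleton a.1 a.2]
    exact h

end Whitehead

end FreeGroup

section FreeFactor

variable {G G' : Type*} [Group G] [Group G']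

/-- `H` is contained in a proper free factor. -/
def InProperFreeFactor (H : Subgroup G) : Prop :=
  ∃ A : Subgroup G, IsFreeFactor A ∧ A ≠ ⊤ ∧ H ≤ A

theorem InProperFreeFactor.mono {H K : Subgroup G} (h : InProperFreeFactor K) (hHK : H ≤ K) :
    InProperFreeFactor H := by
  obtain ⟨A, hA, hA', hK⟩ := h
  exact ⟨A, hA, hA', hHK.trans hK⟩

theorem IsFreeFactor.map (e : G ≃* G') {A : Subgroup G} (h : IsFreeFactor A) :
    IsFreeFactor (A.map e.toMonoidHom) := by
  obtain ⟨B, hB⟩ := h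
  refine ⟨B.map e.toMonoidHom, ?_⟩
  set c := MulEquiv.coprodCongr (e.subgroupMap A) (e.subgroupMap B)
  have key : (Monoid.Coprod.lift (A.map e.toMonoidHom).subtype (B.map e.toMonoidHom).subtype).comp
      c.toMonoidHom = e.toMonoidHom.comp (Monoid.Coprod.lift A.subtype B.subtype) := by
    apply Monoid.Coprod.hom_ext <;> ext x <;> rfl
  have h2 : Function.Bijective
      ((Monoid.Coprod.lift (A.map e.toMonoidHom).subtype (B.map e.toMonoidHom).subtype) ∘ c) := by
    have : ⇑(Monoid.Coprod.lift (A.map e.toMonoidHom).subtype (B.map e.toMonoidHom).subtype) ∘ c =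
      e ∘ (Monoid.Coprod.lift A.subtype B.subtype) := congrArg DFunLike.coe key
    rw [this]
    exact e.bijective.comp hB
  exact (Function.Bijective.of_comp_iff _ c.bijective).1 h2

theorem InProperFreeFactor.of_comap (e : G ≃* G') {H : Subgroup G'}
    (h : InProperFreeFactor (H.comap e.toMonoidHom)) : InProperFreeFactor H := by
  obtain ⟨A, hA, hA', hH⟩ := h
  refine ⟨A.map e.toMonoidHom, hA.map e, ?_, ?_⟩
  · intro h
    apply hA'
    rw [← Subgroup.comap_map_eq_self_of_injective (f := e.toMonoidHom) e.injective A, h,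
      Subgroup.comap_top]
  · rw [← Subgroup.map_comap_eq_self_of_surjective (f := e.toMonoidHom) e.surjective H]
    exact Subgroup.map_mono hH

end FreeFactor

theorem List.exists_adjacent_or_forall {β : Type*} (P : β → Prop) (L : List β) :
    (∃ L₁ x y L₂, L = L₁ ++ x :: y :: L₂ ∧ ¬(P x ↔ P y)) ∨ (∀ a ∈ L, P a) ∨ ∀ a ∈ L, ¬P a := by
  induction L with
  | nil => simp
  | cons a L ih =>
    rcases ih with ⟨L₁, x, y, L₂, rfl, h⟩ | h
    · exact Or.inl ⟨a :: L₁, x, y, L₂, rfl, h⟩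
    · rcases L with _ | ⟨b, L⟩
      · by_cases ha : P a <;> simp [ha]
      · by_cases hab : P a ↔ P b
        · right
          rcases h with h | h
          · left; intro c hc
            rcases List.mem_cons.1 hc with rfl | hc
            · exact hab.2 (h b (by simp))
            · exact h c hc
          · right; intro c hc
            rcases List.mem_cons.1 hc with rfl | hc
            · exact fun h' => h b (by simp) (hab.1 h')
            · exact h c hc
        · exact Or.inl ⟨[], a, b, L, rfl, hab⟩

namespace FreeGroup

variable {α : Type*} [DecidableEq α]

/-- The subgroup generated by the basis elements in `I`. -/
def lettersIn (I : Set α) : Subgroup (FreeGroup α) where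
  carrier := {g | ∀ d ∈ g.toWord, d.1 ∈ I}
  mul_mem' {a b} ha hb d hd := by
    rcases List.mem_append.1 ((toWord_mul_sublist a b).subset hd) with h | h
    · exact ha d h
    · exact hb d h
  one_mem' := by simp
  inv_mem' {a} ha d hd := by
    rw [toWord_inv, invRev] at hd
    simp only [List.mem_reverse, List.mem_map] at hd
    obtain ⟨e, he, rfl⟩ := hd
    exact ha e he

theorem mem_lettersIn {I : Set α} {g : FreeGroup α} :
    g ∈ lettersIn I ↔ ∀ d ∈ g.toWord, d.1 ∈ I := Iff.rfl

theorem mk_mem_lettersIn {I : Set α} {L : List (α × Bool)} (h : ∀ d ∈ L, d.1 ∈ I) :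
    mk L ∈ lettersIn I := fun d hd => by
  rw [toWord_mk] at hd
  exact h d (reduce.red.sublist.subset hd)

theorem of_mem_lettersIn {I : Set α} {i : α} : of i ∈ lettersIn I ↔ i ∈ I := by
  simp [mem_lettersIn]

theorem isFreeFactor_lettersIn (I : Set α) : IsFreeFactor (lettersIn I) := by
  classical
  refine ⟨lettersIn Iᶜ, ?_⟩
  set A := lettersIn I
  set B := lettersIn Iᶜ
  let f : FreeGroup α →* Monoid.Coprod A B := lift fun i =>
    if h : i ∈ I then Monoid.Coprod.inl ⟨of i, of_mem_lettersIn.2 h⟩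
    else Monoid.Coprod.inr ⟨of i, of_mem_lettersIn.2 h⟩
  have h1 : (Monoid.Coprod.lift A.subtype B.subtype).comp f = MonoidHom.id _ := by
    refine ext_hom _ _ fun i => ?_
    by_cases h : i ∈ I <;> simp [f, h]
  have hA : ∀ (L : List (α × Bool)) (hL : ∀ d ∈ L, d.1 ∈ I),
      f (mk L) = Monoid.Coprod.inl ⟨mk L, mk_mem_lettersIn hL⟩ := by
    intro L
    induction L with
    | nil => intro _; exact (_root_.map_one f).trans (_root_.map_one Monoid.Coprod.inl).symm
    | cons d L ih =>
      intro hL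
      have hd : d.1 ∈ I := hL d (by simp)
      have hd' : f (mk [d]) = Monoid.Coprod.inl ⟨mk [d], mk_mem_lettersIn (by simpa using hd)⟩ := by
        rcases d with ⟨i, b⟩
        have h2 : f (of i) = Monoid.Coprod.inl ⟨of i, of_mem_lettersIn.2 hd⟩ := by
          have hd : i ∈ I := hd
          simp [f, hd]
        cases b
        · have h3 : mk [(i, false)] = (of i)⁻¹ := rfl
          simp only [h3, _root_.map_inv, h2]
          rw [← _root_.map_inv]; rfl
        · exact h2
      have h3 : mk (d :: L) = mk [d] * mk L := rfl
      simp only [h3, _root_.map_mul, hd', ih fun e he => hL e (by simp [he])]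
      rw [← _root_.map_mul]; rfl
  have hB : ∀ (L : List (α × Bool)) (hL : ∀ d ∈ L, d.1 ∈ Iᶜ),
      f (mk L) = Monoid.Coprod.inr ⟨mk L, mk_mem_lettersIn hL⟩ := by
    intro L
    induction L with
    | nil => intro _; exact (_root_.map_one f).trans (_root_.map_one Monoid.Coprod.inr).symm
    | cons d L ih =>
      intro hL
      have hd : d.1 ∈ Iᶜ := hL d (by simp)
      have hd' : f (mk [d]) = Monoid.Coprod.inr ⟨mk [d], mk_mem_lettersIn (by simpa using hd)⟩ := by
        rcases d with ⟨i, b⟩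
        have h2 : f (of i) = Monoid.Coprod.inr ⟨of i, of_mem_lettersIn.2 hd⟩ := by
          have hd : i ∉ I := hd
          simp [f, hd]
        cases b
        · have h3 : mk [(i, false)] = (of i)⁻¹ := rfl
          simp only [h3, _root_.map_inv, h2]
          rw [← _root_.map_inv]; rfl
        · exact h2
      have h3 : mk (d :: L) = mk [d] * mk L := rfl
      simp only [h3, _root_.map_mul, hd', ih fun e he => hL e (by simp [he])]
      rw [← _root_.map_mul]; rfl
  have h2 : f.comp (Monoid.Coprod.lift A.subtype B.subtype) = MonoidHom.id _ := by
    apply Monoid.Coprod.hom_ext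
    · ext ⟨x, hx⟩
      have h := hA x.toWord hx
      simp only [mk_toWord] at h
      exact h
    · ext ⟨x, hx⟩
      have h := hB x.toWord hx
      simp only [mk_toWord] at h
      exact h
  exact Function.bijective_iff_has_inverse.2 ⟨f, DFunLike.congr_fun h2, DFunLike.congr_fun h1⟩

theorem inProperFreeFactor_lettersIn {I : Set α} (hI : Iᶜ.Nonempty) :
    InProperFreeFactor (lettersIn I) := by
  refine ⟨_, isFreeFactor_lettersIn I, ?_, le_rfl⟩
  obtain ⟨i, hi⟩ := hI
  intro h
  exact hi (of_mem_lettersIn.1 (h ▸ Subgroup.mem_top (of i)))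

theorem head?_toWord_pow {x : FreeGroup α} (hx : IsCyclicallyReduced x.toWord) {d : α × Bool}
    (hd : x.toWord.head? = some d) (n : ℕ) : (x ^ (n + 1)).toWord.head? = some d := by
  rw [toWord_pow, (hx.flatten_replicate _).isReduced.reduce_eq, List.replicate_succ,
    List.flatten_cons, List.head?_append, hd]
  rfl

theorem isReduced_of_length_le_norm {L : List (α × Bool)} (h : L.length ≤ norm (mk L)) :
    IsReduced L := by
  rw [isReduced_iff_reduce_eq]
  refine reduce.red.sublist.eq_of_length_le ?_
  rwa [norm, toWord_mk] at h

theorem norm_letter_mul_lt {g : FreeGroup α} {d : α × Bool} (h : g.toWord.head? = some d) :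
    norm (mk [letterInv d] * g) < norm g := by
  obtain ⟨L, hL⟩ : ∃ L, g.toWord = d :: L := by
    rcases hL : g.toWord with _ | ⟨e, L⟩
    · simp [hL] at h
    · rw [hL] at h; simp at h; exact ⟨L, by rw [h]⟩
  have h1 : g = mk [d] * mk L := by rw [← mk_toWord (x := g), hL]; rfl
  have h2 : mk [letterInv d] * g = mk L := by rw [h1, ← inv_letter, inv_mul_cancel_left]
  rw [h2]
  refine lt_of_le_of_lt norm_mk_le ?_
  simp [norm, hL]

theorem norm_mul_letter_lt {g : FreeGroup α} {d : α × Bool} (h : g.toWord.getLast? = some d) :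
    norm (g * mk [letterInv d]) < norm g := by
  rcases toWord_mul_letter g (letterInv d) with ⟨L, h1, h2⟩ | ⟨-, h2⟩
  · simp [norm, h1, h2]
  · rw [letterInv_letterInv] at h2
    exact absurd h h2

/-- A subgroup meeting `lettersIn I` nontrivially and with no left coset split by the cone of the
letters of `I` is contained in `lettersIn I`. -/
theorem le_lettersIn_of_not_splits {I : Set α} {K : Subgroup (FreeGroup α)}
    (hK : ∀ p : FreeGroup α, ¬Splits (cone {d | d.1 ∈ I}) {x | p * x ∈ K}) {w : FreeGroup α}
    (hw : w ∈ lettersIn I) (hwK : w ∈ K) (hw1 : w ≠ 1) : K ≤ lettersIn I := by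
  intro g hg
  by_contra hgI
  obtain ⟨⟨p, y⟩, ⟨hp, hy⟩, hmin⟩ := exists_minimalFor_of_wellFoundedLT
    (fun q : FreeGroup α × FreeGroup α => q.1 ∈ lettersIn I ∧ q.2 ∈ lettersIn I)
    (fun q => norm (q.1⁻¹ * g * q.2)) ⟨(1, 1), one_mem _, one_mem _⟩
  simp only at hp hy
  set m := p⁻¹ * g * y with hm
  have hletter : ∀ d : α × Bool, d.1 ∈ I → mk [d] ∈ lettersIn I := fun d hd =>
    mk_mem_lettersIn (by simpa using hd)
  have hmI : m ∉ lettersIn I := fun h => hgI (by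
    have : g = p * m * y⁻¹ := by rw [hm]; group
    rw [this]
    exact mul_mem (mul_mem hp h) (inv_mem hy))
  have hne : m.toWord ≠ [] := fun h => hmI (by rw [toWord_eq_nil_iff] at h; rw [h]; exact one_mem _)
  obtain ⟨d, hd⟩ : ∃ d, m.toWord.head? = some d := by
    rcases h : m.toWord with _ | ⟨e, L⟩
    · exact absurd h hne
    · exact ⟨e, rfl⟩
  obtain ⟨e, he⟩ : ∃ e, m.toWord.getLast? = some e := ⟨_, List.getLast?_eq_getLast_of_ne_nil hne⟩
  have hdI : d.1 ∉ I := fun h => by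
    have h1 := norm_letter_mul_lt hd
    have h2 := hmin (j := (p * mk [d], y)) ⟨mul_mem hp (hletter d h), hy⟩
    simp only [mul_inv_rev, inv_letter, mul_assoc] at h1 h2 hm
    rw [hm] at h1
    have := h2 h1.le
    omega
  have heI : e.1 ∉ I := fun h => by
    have h1 := norm_mul_letter_lt he
    have h2 := hmin (j := (p, y * mk [letterInv e])) ⟨hp, mul_mem hy (hletter _ h)⟩
    simp only [mul_assoc] at h1 h2 hm
    rw [hm] at h1
    simp only [mul_assoc] at h1
    have := h2 h1.le
    omega
  have hstart : ∀ u ∈ lettersIn I, m * u ∉ cone {d | d.1 ∈ I} := by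
    intro u hu
    have : (m * u).toWord = m.toWord ++ u.toWord := by
      rw [toWord_mul]
      apply IsReduced.reduce_eq
      refine List.IsChain.append isReduced_toWord isReduced_toWord ?_
      intro a ha b hb hab
      rw [he] at ha
      obtain rfl : e = a := by simpa using ha
      exact absurd (hab ▸ hu b (List.mem_of_mem_head? hb)) heI
    rw [mem_cone_of_head? (d := d) (by rw [this, List.head?_append, hd]; rfl)]
    exact hdI
  have hinj : Function.Injective fun n : ℕ => w ^ n := IsMulTorsionFree.pow_right_injective hw1
  refine hK p ⟨?_, ?_⟩
  · have hinf : (Set.range (fun n : ℕ => p⁻¹ * w ^ n) \ {1}).Infinite :=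
      (Set.infinite_range_of_injective ((mul_right_injective p⁻¹).comp hinj)).sdiff
        (Set.finite_singleton 1)
    refine hinf.mono ?_
    rintro _ ⟨⟨n, rfl⟩, hn⟩
    refine ⟨by simpa using pow_mem hwK n, ?_⟩
    have hmem : p⁻¹ * w ^ n ∈ lettersIn I := mul_mem (inv_mem hp) (pow_mem hw n)
    simp only at hn ⊢
    generalize p⁻¹ * w ^ n = z at *
    rcases hz : z.toWord with _ | ⟨c, L⟩
    · exact absurd (toWord_eq_nil_iff.1 hz) hn
    · exact ⟨c, hmem c (by simp [hz]), by rw [hz]; rfl⟩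
  · refine (Set.infinite_range_of_injective
      ((mul_right_injective (p⁻¹ * g)).comp hinj)).mono ?_
    rintro _ ⟨n, rfl⟩
    refine ⟨?_, ?_⟩
    · simpa [mul_assoc] using mul_mem hg (pow_mem hwK n)
    · have := hstart (y⁻¹ * w ^ n) (mul_mem (inv_mem hy) (pow_mem hw n))
      rw [hm] at this
      simpa [mul_assoc] using this

theorem splits_cone_compl (U : Set (α × Bool)) (Y : Set (FreeGroup α)) :
    Splits (cone Uᶜ) Y ↔ Splits (cone U) Y := by
  rw [← splits_compl]
  refine splits_congr (Set.finite_singleton 1) fun g _ hg => ?_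
  rcases h : g.toWord with _ | ⟨e, L⟩
  · exact absurd (toWord_eq_nil_iff.1 h) hg
  · rw [Set.mem_compl_iff, mem_cone_of_head? (d := e) (by rw [h]; rfl),
      mem_cone_of_head? (d := e) (by rw [h]; rfl)]
    simp

/-- A subgroup none of whose left cosets is split by the cone of the letters of a nonempty proper
part of the basis is contained in a proper free factor. -/
theorem inProperFreeFactor_of_not_splits_cone {I : Set α} (hI : I.Nonempty) (hI' : Iᶜ.Nonempty)
    {H : Subgroup (FreeGroup α)} (hH : ∀ x, ¬Splits (cone {d | d.1 ∈ I}) (cosetOf x H)) :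
    InProperFreeFactor H := by
  by_cases hbot : H = ⊥
  · exact (inProperFreeFactor_lettersIn hI').mono (hbot ▸ bot_le)
  obtain ⟨h₀, hh₀, hh₀1⟩ := H.bot_or_exists_ne_one.resolve_left hbot
  obtain ⟨w, ⟨hw1, k, hwk⟩, hmin⟩ := exists_minimalFor_of_wellFoundedLT
    (fun w : FreeGroup α => w ≠ 1 ∧ ∃ k, k * w * k⁻¹ ∈ H) norm ⟨h₀, hh₀1, 1, by simpa using hh₀⟩
  have hconj : ∀ k p : FreeGroup α, ¬Splits (cone {d | d.1 ∈ I})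
      {x | p * x ∈ H.comap (MulAut.conj k).toMonoidHom} := by
    intro k p
    have := (AlmostInvariant.splits_mul_right (Y := cosetOf (k * p)⁻¹ H)
      (almostInvariant_cone {d : α × Bool | d.1 ∈ I}) k⁻¹).not.2 (hH _)
    convert this using 2
    ext x
    simp [mem_cosetOf, mul_assoc]
  have hwk' : w ∈ H.comap (MulAut.conj k).toMonoidHom := by simpa using hwk
  rcases List.exists_adjacent_or_forall (fun d : α × Bool => d.1 ∈ I) w.toWord with
    ⟨L₁, x, y, L₂, hL, hxy⟩ | h | h
  · exfalso
    set p := mk (L₁ ++ [x])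
    set v := mk (y :: L₂ ++ (L₁ ++ [x])) with hv
    have hwp : w = p * mk (y :: L₂) := by rw [← mk_toWord (x := w), hL, mul_mk]; simp
    have hvp : v = p⁻¹ * w * p := by rw [hwp, hv, ← mul_mk]; simp only [p]; group
    have hv1 : v ≠ 1 := by
      rw [hvp]; intro h; apply hw1
      have : w = p * (p⁻¹ * w * p) * p⁻¹ := by group
      rw [this, h]; simp
    have hvH : v ∈ H.comap (MulAut.conj (k * p)).toMonoidHom := by
      simpa [hvp, mul_assoc] using hwk
    have hle : norm w ≤ norm v := by
      by_contra hlt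
      exact hlt (hmin (j := v) ⟨hv1, k * p, hvH⟩ (not_le.1 hlt).le)
    have hred : IsReduced (y :: L₂ ++ (L₁ ++ [x])) := by
      apply isReduced_of_length_le_norm
      refine le_trans (le_of_eq ?_) hle
      rw [norm, hL]; simp; omega
    have hvw : v.toWord = y :: L₂ ++ (L₁ ++ [x]) := toWord_mk_of_isReduced hred
    have hxy1 : x.1 ≠ y.1 := fun h => hxy (by simp only [h])
    have hcyc : IsCyclicallyReduced v.toWord := by
      rw [hvw, isCyclicallyReduced_iff]
      refine ⟨hred, ?_⟩
      intro a ha b hb hab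
      have ha' : x = a := by
        rw [List.getLast?_append, List.getLast?_append] at ha; simpa using ha
      have hb' : y = b := by simpa using hb
      exact absurd (ha' ▸ hb' ▸ hab) hxy1
    have hcyc' : IsCyclicallyReduced v⁻¹.toWord := by
      rw [isCyclicallyReduced_iff]
      refine ⟨isReduced_toWord, ?_⟩
      rw [toWord_inv, hvw, invRev]
      intro a ha b hb hab
      have ha' : (y.1, !y.2) = a := by
        rw [List.getLast?_reverse, List.map_append, List.map_cons] at ha; simpa using ha
      have hb' : (x.1, !x.2) = b := by simpa using hb
      rw [← ha', ← hb'] at hab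
      exact absurd hab.symm hxy1
    have h1 := head?_toWord_pow hcyc (d := y) (by rw [hvw]; rfl)
    have h2 := head?_toWord_pow hcyc' (d := letterInv x)
      (by rw [toWord_inv, hvw, invRev]; simp [letterInv])
    have hinf : ∀ u : FreeGroup α, u ≠ 1 → (Set.range fun n : ℕ => u ^ (n + 1)).Infinite :=
      fun u hu => Set.infinite_range_of_injective
        ((IsMulTorsionFree.pow_right_injective hu).comp (add_left_injective 1))
    have hYv : (Set.range fun n : ℕ => v ^ (n + 1)) ⊆
        {x | 1 * x ∈ H.comap (MulAut.conj (k * p)).toMonoidHom} := by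
      rintro _ ⟨n, rfl⟩
      rw [Set.mem_ofPred_eq, one_mul]
      exact pow_mem hvH _
    have hYv' : (Set.range fun n : ℕ => v⁻¹ ^ (n + 1)) ⊆
        {x | 1 * x ∈ H.comap (MulAut.conj (k * p)).toMonoidHom} := by
      rintro _ ⟨n, rfl⟩
      rw [Set.mem_ofPred_eq, one_mul]
      exact pow_mem (inv_mem hvH) _
    have hmem : ∀ n, v ^ (n + 1) ∈ cone {d : α × Bool | d.1 ∈ I} ↔ y.1 ∈ I := fun n =>
      mem_cone_of_head? (h1 n)
    have hmem' : ∀ n, v⁻¹ ^ (n + 1) ∈ cone {d : α × Bool | d.1 ∈ I} ↔ x.1 ∈ I := fun n =>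
      mem_cone_of_head? (d := letterInv x) (h2 n)
    refine hconj (k * p) 1 ?_
    by_cases hy : y.1 ∈ I
    · have hx : x.1 ∉ I := fun hx => hxy (iff_of_true hx hy)
      refine ⟨(hinf v hv1).mono (Set.subset_inter hYv ?_),
        (hinf v⁻¹ (inv_ne_one.2 hv1)).mono fun z hz => ⟨hYv' hz, ?_⟩⟩
      · rintro _ ⟨n, rfl⟩; exact (hmem n).2 hy
      · obtain ⟨n, rfl⟩ := hz; exact fun h => hx ((hmem' n).1 h)
    · have hx : x.1 ∈ I := by_contra fun hx => hxy (iff_of_false hx hy)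
      refine ⟨(hinf v⁻¹ (inv_ne_one.2 hv1)).mono (Set.subset_inter hYv' ?_),
        (hinf v hv1).mono fun z hz => ⟨hYv hz, ?_⟩⟩
      · rintro _ ⟨n, rfl⟩; exact (hmem' n).2 hx
      · obtain ⟨n, rfl⟩ := hz; exact fun h => hy ((hmem n).1 h)
  · exact InProperFreeFactor.of_comap (MulAut.conj k)
      ((inProperFreeFactor_lettersIn hI').mono
        (le_lettersIn_of_not_splits (hconj k) h hwk' hw1))
  · refine InProperFreeFactor.of_comap (MulAut.conj k)
      ((inProperFreeFactor_lettersIn (I := Iᶜ) (by rwa [compl_compl])).mono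
        (le_lettersIn_of_not_splits (fun p => ?_) h hwk' hw1))
    exact (splits_cone_compl _ _).not.2 (hconj k p)

theorem inProperFreeFactor_of_splitCosets_cone_eq_empty [Nontrivial α] {Z : Set (α × Bool)}
    (hZ : Z.Nonempty) (hZ' : Zᶜ.Nonempty) {H : Subgroup (FreeGroup α)}
    (hH : splitCosets (cone Z) H = ∅) : InProperFreeFactor H := by
  by_cases h : ∃ a ∈ Z, letterInv a ∉ Z
  · obtain ⟨a, ha, ha'⟩ := h
    refine InProperFreeFactor.of_comap (whitehead a Z) ?_
    have h1 : splitCosets (cone {a}) (H.comap (whitehead a Z).toMonoidHom) = ∅ := by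
      have h2 := splitCosets_preimage (whitehead a Z) (cone Z) H
      rw [hH, Set.image_empty] at h2
      rcases whitehead_preimage_cone ha ha' with h3 | h3 <;> rw [h3] at h2
      · exact h2
      · rwa [splitCosets_compl] at h2
    have h2 := splitCosets_cone_letterInv_eq_empty h1
    rw [splitCosets_eq_empty] at h1 h2
    refine inProperFreeFactor_of_not_splits_cone (I := {a.1}) ⟨a.1, rfl⟩ ?_ fun x => ?_
    · obtain ⟨b, hb⟩ := exists_ne a.1
      exact ⟨b, hb⟩
    · convert not_splits_union (h1 x) (h2 x) using 2
      ext g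
      rcases hg : g.toWord with _ | ⟨⟨i, b⟩, L⟩
      · rw [toWord_eq_nil_iff] at hg
        subst hg
        simp [one_notMem_cone]
      · have hh : g.toWord.head? = some (i, b) := by rw [hg]; rfl
        rw [Set.mem_union, mem_cone_of_head? hh, mem_cone_of_head? hh, mem_cone_of_head? hh]
        rcases a with ⟨j, c⟩
        cases b <;> cases c <;> simp [letterInv]
  · push Not at h
    have hI : Z = {d | d.1 ∈ {i | (i, true) ∈ Z}} := by
      ext ⟨i, b⟩
      cases b
      · exact ⟨fun hd => h _ hd, fun hd => h _ hd⟩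
      · rfl
    refine inProperFreeFactor_of_not_splits_cone (I := {i | (i, true) ∈ Z}) ?_ ?_
      (splitCosets_eq_empty.1 (hI ▸ hH))
    · obtain ⟨d, hd⟩ := hZ
      rw [hI] at hd
      exact ⟨d.1, hd⟩
    · obtain ⟨d, hd⟩ := hZ'
      rw [hI] at hd
      exact ⟨d.1, hd⟩

/-- The elements whose reduced word can follow that of `p` without cancellation. -/
def follow (p : FreeGroup α) : Set (FreeGroup α) :=
  {g | ∀ d, p.toWord.getLast? = some (letterInv d) → g.toWord.head? ≠ some d}

theorem toWord_mul_of_mem_follow {p g : FreeGroup α} (h : g ∈ follow p) :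
    (p * g).toWord = p.toWord ++ g.toWord := by
  rw [toWord_mul]
  apply IsReduced.reduce_eq
  refine List.IsChain.append isReduced_toWord isReduced_toWord ?_
  intro a ha b hb hab
  by_contra hne
  refine h b ?_ hb
  rw [ha]
  congr 1
  ext
  · exact hab
  · simp only [letterInv]
    revert hne; cases a.2 <;> cases b.2 <;> simp

theorem mem_iff_of_mem_follow {A : Set (FreeGroup α)} {r : ℕ}
    (hr : ∀ d, ∀ g ∈ rightBoundary A (mk [d]), norm g ≤ r) {p : FreeGroup α} (hp : r < norm p)
    (g : FreeGroup α) (hg : g ∈ follow p) : p * g ∈ A ↔ p ∈ A := by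
  obtain ⟨L, hL⟩ : ∃ L, L = g.toWord := ⟨_, rfl⟩
  induction L using List.reverseRecOn generalizing g with
  | nil => rw [toWord_eq_nil_iff.1 hL.symm, mul_one]
  | append_singleton L e ih =>
    have hred : IsReduced L := List.IsChain.left_of_append (hL ▸ isReduced_toWord (x := g))
    have h1 : L = (mk L).toWord := (toWord_mk_of_isReduced hred).symm
    have h2 : g = mk L * mk [e] := by rw [← mk_toWord (x := g), ← hL, mul_mk]
    have h3 : mk L ∈ follow p := by
      intro d hd h
      refine hg d hd ?_
      rw [← h1] at h
      rw [← hL, List.head?_append, h]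
      rfl
    rw [← ih _ h3 h1, h2, ← mul_assoc]
    by_contra hne
    have := hr e (p * mk L) fun h => hne h.symm
    rw [norm, toWord_mul_of_mem_follow h3, List.length_append] at this
    rw [norm] at hp
    omega

/-- An infinite and coinfinite almost invariant set has a translate which splits no cone of a
letter, up to excluding at most one letter, and which does split the union of these cones. -/
theorem exists_extremal [Fintype α] {A : Set (FreeGroup α)} (hA : AlmostInvariant A)
    (h1 : A.Infinite) (h2 : Aᶜ.Infinite) : ∃ (p : FreeGroup α) (E : Set (α × Bool)),
      E.Subsingleton ∧ (∀ d ∉ E, ¬Splits {g | p * g ∈ A} (cone {d})) ∧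
        Splits {g | p * g ∈ A} (cone Eᶜ) := by
  obtain ⟨r, hr⟩ : ∃ r, ∀ d, ∀ g ∈ rightBoundary A (mk [d]), norm g ≤ r := by
    have hf : (⋃ d : α × Bool, rightBoundary A (mk [d])).Finite := Set.finite_iUnion fun d => hA _
    obtain ⟨r, hr⟩ := (hf.image norm).bddAbove
    exact ⟨r, fun d g hg => hr ⟨g, Set.mem_iUnion.2 ⟨d, hg⟩, rfl⟩⟩
  have hS1 : Splits {g | 1 * g ∈ A} (follow 1) := by
    have : follow (1 : FreeGroup α) = Set.univ := by
      ext; simp [follow]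
    simp only [one_mul, this]
    refine ⟨by simpa using h1, by simpa [← Set.compl_eq_univ_sdiff] using h2⟩
  obtain ⟨p, hp, hmin⟩ := exists_minimalFor_of_wellFoundedLT
    (fun p : FreeGroup α => Splits {g | p * g ∈ A} (follow p)) (fun p => r + 1 - norm p) ⟨1, hS1⟩
  have hpr : norm p ≤ r := by
    by_contra hlt
    have hc := mem_iff_of_mem_follow hr (not_le.1 hlt)
    by_cases hpA : p ∈ A
    · exact hp.2 (by convert Set.finite_empty; ext g; simpa using fun hg => (hc g hg).2 hpA)
    · exact hp.1 (by convert Set.finite_empty; ext g; simpa using fun hg => (hc g hg).not.2 hpA)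
  set E : Set (α × Bool) := {d | p.toWord.getLast? = some (letterInv d)} with hE
  have hinj : Function.Injective (letterInv : α × Bool → α × Bool) :=
    Function.Involutive.injective letterInv_letterInv
  refine ⟨p, E, ?_, ?_, ?_⟩
  · intro d hd e he
    simp only [hE, Set.mem_ofPred_eq] at hd he
    rw [hd] at he
    exact hinj (Option.some_injective _ he)
  · intro d hd hs
    have hw : (p * mk [d]).toWord = p.toWord ++ [d] := by
      rw [toWord_mul_of_mem_follow, toWord_letter]
      intro e he h
      apply hd
      have : d = e := by simpa [toWord_letter] using h
      rw [this]
      exact he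
    have hsplit : Splits {g | p * mk [d] * g ∈ A} (follow (p * mk [d])) := by
      have h := (splits_preimage (Equiv.mulLeft (mk [d])) (A := {g | p * g ∈ A})).2 hs
      have hfol : follow (p * mk [d]) = Equiv.mulLeft (mk [d]) ⁻¹' cone {d} := by
        have key : ∀ g, g ∈ follow (p * mk [d]) ↔ g.toWord.head? ≠ some (letterInv d) := by
          intro g
          simp only [follow, hw, Set.mem_ofPred_eq, List.getLast?_append, List.getLast?_singleton,
            Option.some_or, Option.some.injEq]
          constructor
          · intro h; exact h _ (letterInv_letterInv d).symm
          · rintro h e rfl; rwa [letterInv_letterInv] at h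
        ext g
        rw [key]
        constructor
        · intro hg
          have : g ∈ follow (mk [d]) := by
            intro e he h'
            have : d = letterInv e := by simpa [toWord_letter] using he
            rw [this, letterInv_letterInv] at hg
            exact hg h'
          refine ⟨d, rfl, ?_⟩
          rw [Equiv.coe_mulLeft, toWord_mul_of_mem_follow this]
          rfl
        · rintro ⟨d', hdd, hd'⟩ hg
          rw [Equiv.coe_mulLeft, Set.mem_singleton_iff.1 hdd] at hd'
          obtain ⟨L, hL⟩ : ∃ L, g.toWord = letterInv d :: L := by
            rcases hL : g.toWord with _ | ⟨e, L⟩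
            · simp [hL] at hg
            · rw [hL] at hg; exact ⟨L, by rw [Option.some_injective _ hg]⟩
          have hred : IsReduced (letterInv d :: L) := hL ▸ isReduced_toWord
          have hLred : IsReduced L := hred.tail
          have h3 : mk [d] * g = mk L := by
            have h4 : g = mk [letterInv d] * mk L := by
              rw [← mk_toWord (x := g), hL]; rfl
            rw [h4, ← inv_letter, mul_inv_cancel_left]
          change (mk [d] * g).toWord.head? = some d at hd'
          rw [h3, toWord_mk_of_isReduced hLred] at hd'
          rcases L with _ | ⟨e, L⟩
          · simp at hd'
          · obtain rfl := Option.some_injective _ hd'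
            have := (isReduced_cons_cons.1 hred).1 rfl
            simp [letterInv] at this
      rw [hfol]
      convert h using 1
      ext g
      simp [mul_assoc]
    have h3 := hmin (j := p * mk [d]) hsplit
    simp only [norm, hw, List.length_append, List.length_singleton] at h3 hpr
    omega
  · refine ⟨fun hf => hp.1 ((hf.union (Set.finite_singleton 1)).subset ?_),
      fun hf => hp.2 ((hf.union (Set.finite_singleton 1)).subset ?_)⟩
    all_goals
      rintro g ⟨hg, hgA⟩
      rcases hL : g.toWord with _ | ⟨e, L⟩
      · exact Or.inr (toWord_eq_nil_iff.1 hL)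
      · have he : g.toWord.head? = some e := by rw [hL]; rfl
        exact Or.inl ⟨⟨e, fun h => hg e h he, he⟩, hgA⟩

/-- If `U`, `W` and `{η}` partition the letters, `A` almost contains the cone of `U` and almost
avoids the cone of `W`, then a set split by the cone of `U` but not by `A` is split by the cone of
`η` and not by that of `W`. -/
theorem splits_cone_of_splits {A Y : Set (FreeGroup α)} {U W : Set (α × Bool)} {η : α × Bool}
    (hηU : η ∉ U) (hcov : ∀ d, d ∈ U ∨ d ∈ W ∨ d = η)
    (hU : (cone U \ A).Finite) (hW : (cone W ∩ A).Finite) (hA : ¬Splits A Y)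
    (hY : Splits (cone U) Y) : Splits (cone {η}) Y ∧ ¬Splits (cone W) Y := by
  have h1 : (Y ∩ A).Infinite := fun hf => hY.1 ((hf.union hU).subset fun g hg => by
    by_cases h : g ∈ A
    · exact Or.inl ⟨hg.1, h⟩
    · exact Or.inr ⟨hg.2, h⟩)
  have h2 : (Y \ A).Finite := (not_splits.1 hA).resolve_left h1
  have h3 : (Y ∩ cone W).Finite := (h2.union hW).subset fun g hg => by
    by_cases h : g ∈ A
    · exact Or.inr ⟨hg.2, h⟩
    · exact Or.inl ⟨hg.1, h⟩
  refine ⟨⟨fun hf => hY.2 (((hf.union h3).union (Set.finite_singleton 1)).subset fun g hg => ?_),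
    fun hf => hY.1 (hf.subset fun g hg => ⟨hg.1, ?_⟩)⟩, not_splits.2 (Or.inl h3)⟩
  · rcases hL : g.toWord with _ | ⟨e, L⟩
    · exact Or.inr (toWord_eq_nil_iff.1 hL)
    · have he : g.toWord.head? = some e := by rw [hL]; rfl
      have h := hg.2
      rw [mem_cone_of_head? he] at h
      rcases (hcov e).resolve_left h with h | h
      · exact Or.inl (Or.inr ⟨hg.1, (mem_cone_of_head? he).2 h⟩)
      · exact Or.inl (Or.inl ⟨hg.1, (mem_cone_of_head? he).2 h⟩)
  · rintro ⟨d, rfl, hd⟩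
    exact hηU ((mem_cone_of_head? hd).1 hg.2)

theorem inProperFreeFactor_or_exists_lt [Fintype α] [Nontrivial α] {H : Subgroup (FreeGroup α)}
    (hfin : ∀ A, AlmostInvariant A → (splitCosets A H).Finite) {A : Set (FreeGroup α)}
    {U W : Set (α × Bool)} {η : α × Bool} (hηU : η ∉ U) (hηW : η ∉ W)
    (hcov : ∀ d, d ∈ U ∨ d ∈ W ∨ d = η) (hU : (cone U \ A).Finite) (hW : (cone W ∩ A).Finite)
    (hA : splitCosets A H = ∅) (hWne : W.Nonempty) (hη : letterInv η ∈ U) :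
    InProperFreeFactor H ∨
      ∃ e : FreeGroup α ≃* FreeGroup α, cosetComplexity (H.comap e.toMonoidHom) < cosetComplexity H := by
  rw [splitCosets_eq_empty] at hA
  rcases (splitCosets (cone W) H).eq_empty_or_nonempty with hE | ⟨_, ⟨x, rfl⟩, hx⟩
  · exact Or.inl (inProperFreeFactor_of_splitCosets_cone_eq_empty hWne ⟨η, hηW⟩ hE)
  · right
    refine ⟨whitehead (letterInv η) U, cosetComplexity_whitehead_lt hη
      (by rwa [letterInv_letterInv]) ?_⟩
    rw [ncard_splitCosets_cone_letterInv]
    refine Set.ncard_lt_ncard ?_ (hfin _ (almostInvariant_cone _))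
    have h2 := splits_cone_of_splits (A := Aᶜ) (W := U) hηW (by have := hcov; grind)
      (by rwa [sdiff_compl]) (by rwa [← Set.sdiff_eq]) (splits_compl.not.2 (hA x)) hx
    refine Set.ssubset_iff_subset_ne.2 ⟨?_, fun h => ?_⟩
    · rintro _ ⟨⟨y, rfl⟩, hy⟩
      exact ⟨⟨y, rfl⟩, (splits_cone_of_splits hηU hcov hU hW (hA y) hy).1⟩
    · have h3 : cosetOf x H ∈ splitCosets (cone {η}) H := ⟨⟨x, rfl⟩, h2.1⟩
      rw [← h] at h3
      exact h2.2 h3.2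

theorem finite_cone_sdiff [Fintype α] {A : Set (FreeGroup α)} {U : Set (α × Bool)}
    (h : ∀ d ∈ U, (cone {d} \ A).Finite) : (cone U \ A).Finite := by
  refine ((Set.toFinite U).biUnion h).subset ?_
  rintro g ⟨⟨d, hd, hg⟩, hgA⟩
  exact Set.mem_biUnion hd ⟨⟨d, rfl, hg⟩, hgA⟩

/-- A subgroup of a free group lies in a proper free factor if some nontrivial almost invariant set
splits none of its left cosets (and every almost invariant set splits only finitely many). -/
theorem inProperFreeFactor_of_almostInvariant [Fintype α] [Nontrivial α]
    (H : Subgroup (FreeGroup α)) (hfin : ∀ A, AlmostInvariant A → (splitCosets A H).Finite)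
    (hA : ∃ A : Set (FreeGroup α), AlmostInvariant A ∧ A.Infinite ∧ Aᶜ.Infinite ∧
      splitCosets A H = ∅) : InProperFreeFactor H := by
  induction hn : cosetComplexity H using Nat.strong_induction_on generalizing H with
  | _ n ih =>
  suffices h : InProperFreeFactor H ∨ ∃ e : FreeGroup α ≃* FreeGroup α,
      cosetComplexity (H.comap e.toMonoidHom) < cosetComplexity H by
    rcases h with h | ⟨e, he⟩
    · exact h
    · refine InProperFreeFactor.of_comap e (ih _ (hn ▸ he) _ ?_ ?_ rfl)
      · intro B hB
        have h1 := splitCosets_preimage e (e.symm ⁻¹' B) H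
        have h2 : e ⁻¹' (e.symm ⁻¹' B) = B := by ext; simp
        rw [h2] at h1
        rw [h1]
        exact (hfin _ (hB.preimage e.symm)).image _
      · obtain ⟨A, hA1, hA2, hA3, hA4⟩ := hA
        refine ⟨e ⁻¹' A, hA1.preimage e, ?_, ?_, ?_⟩
        · exact fun h => hA2 (h.of_preimage e.surjective)
        · exact fun h => hA3 (Set.Finite.of_preimage (f := e) h e.surjective)
        · rw [splitCosets_preimage, hA4, Set.image_empty]
  obtain ⟨A, hA1, hA2, hA3, hA4⟩ := hA
  obtain ⟨p, E, hE, hE1, hE2⟩ := exists_extremal hA1 hA2 hA3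
  set B : Set (FreeGroup α) := {g | p * g ∈ A} with hB
  have hBH : splitCosets B H = ∅ := by
    rw [hB, splitCosets_preimage_mul_left, hA4, Set.image_empty]
  set U : Set (α × Bool) := {d | d ∉ E ∧ (cone {d} \ B).Finite} with hU
  set W : Set (α × Bool) := {d | d ∉ E ∧ ¬(cone {d} \ B).Finite} with hW
  have hUf : (cone U \ B).Finite := finite_cone_sdiff fun d hd => hd.2
  have hWf : (cone W \ Bᶜ).Finite := finite_cone_sdiff fun d hd => by
    rw [sdiff_compl]
    exact (not_splits.1 (hE1 d hd.1)).resolve_right hd.2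
  have hWne : W.Nonempty := by
    by_contra hne
    refine hE2.2 (hUf.subset ?_)
    rintro g ⟨⟨d, hd, hg⟩, hgB⟩
    refine ⟨⟨d, ⟨hd, by_contra fun h => hne ⟨d, hd, h⟩⟩, hg⟩, hgB⟩
  have hUne : U.Nonempty := by
    by_contra hne
    refine hE2.1 (hWf.subset ?_)
    rintro g ⟨⟨d, hd, hg⟩, hgB⟩
    exact ⟨⟨d, ⟨hd, fun h => hne ⟨d, hd, h⟩⟩, hg⟩, fun h => h hgB⟩
  rcases hE.eq_empty_or_singleton with hE0 | ⟨η, hE0⟩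
  · left
    refine inProperFreeFactor_of_splitCosets_cone_eq_empty hUne
      (hWne.mono fun d hd hd' => hd.2 hd'.2) ?_
    rw [splitCosets_eq_empty] at hBH ⊢
    refine fun x hx => hBH x (splits_of_almost_eq ((hUf.union hWf).union (Set.finite_singleton 1))
      (fun g _ hg => ?_) hx)
    rcases hL : g.toWord with _ | ⟨e, L⟩
    · exact absurd (Or.inr (toWord_eq_nil_iff.1 hL)) hg
    · have he : g.toWord.head? = some e := by rw [hL]; rfl
      have h1 : g ∈ cone W ↔ ¬g ∈ cone U := by
        rw [mem_cone_of_head? he, mem_cone_of_head? he]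
        simp [hU, hW, hE0]
      simp only [Set.mem_union, Set.mem_sdiff, h1, Set.mem_compl_iff, not_or] at hg
      tauto
  · have hηU : η ∉ U := fun h => h.1 (by rw [hE0]; rfl)
    have hηW : η ∉ W := fun h => h.1 (by rw [hE0]; rfl)
    have hcov : ∀ d, d ∈ U ∨ d ∈ W ∨ d = η := by
      intro d
      by_cases hd : d = η
      · exact Or.inr (Or.inr hd)
      · have : d ∉ E := by rw [hE0]; exact hd
        by_cases h : (cone {d} \ B).Finite
        · exact Or.inl ⟨this, h⟩
        · exact Or.inr (Or.inl ⟨this, h⟩)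
    rcases hcov (letterInv η) with h | h | h
    · exact inProperFreeFactor_or_exists_lt hfin hηU hηW hcov hUf
        (by rwa [sdiff_compl] at hWf) hBH hWne h
    · exact inProperFreeFactor_or_exists_lt hfin hηW hηU (by grind) hWf
        (by rwa [← Set.sdiff_eq]) (by rwa [splitCosets_compl]) hUne h
    · exact absurd h (letterInv_ne η)

end FreeGroup

namespace SimpleGraph

variable {V : Type*} {Γ : SimpleGraph V}

/-- The side of `q` of the edge `{p, q}` of a tree. -/
def half (Γ : SimpleGraph V) (p q : V) : Set V := {x | Γ.dist x q < Γ.dist x p}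

theorem mem_half {p q x : V} : x ∈ Γ.half p q ↔ Γ.dist x q < Γ.dist x p := Iff.rfl

theorem IsTree.notMem_half (h : Γ.IsTree) {p q x : V} (hpq : Γ.Adj p q) :
    x ∉ Γ.half p q ↔ x ∈ Γ.half q p := by
  have := h.dist_ne_of_adj x hpq
  simp only [mem_half]; omega

theorem Adj.right_mem_half {p q : V} (hpq : Γ.Adj p q) : q ∈ Γ.half p q := by
  rw [mem_half, dist_self, dist_eq_one_iff_adj.2 hpq.symm]; exact one_pos

theorem left_notMem_half {p q : V} : p ∉ Γ.half p q := by simp [mem_half]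

theorem IsTree.dist_eq_of_mem_half (h : Γ.IsTree) {p q x : V} (hpq : Γ.Adj p q)
    (hx : x ∈ Γ.half p q) : Γ.dist x p = Γ.dist x q + 1 := by
  have := h.dist_eq_dist_add_one_of_adj x hpq
  rw [mem_half] at hx; omega

theorem IsTree.exists_mem_half (h : Γ.IsTree) {p x : V} (hx : x ≠ p) :
    ∃ q, Γ.Adj p q ∧ x ∈ Γ.half p q := by
  obtain ⟨w, hw⟩ := h.connected.exists_walk_length_eq_dist p x
  cases w with
  | nil => exact absurd rfl hx
  | cons hpq w =>
    refine ⟨_, hpq, ?_⟩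
    have := dist_le w
    rw [Walk.length_cons] at hw
    rw [mem_half, dist_comm, dist_comm (v := p)]; omega

theorem IsTree.eq_of_mem_half (h : Γ.IsTree) {p q r x : V} (hq : Γ.Adj p q) (hr : Γ.Adj p r)
    (hxq : x ∈ Γ.half p q) (hxr : x ∈ Γ.half p r) : q = r := by
  obtain ⟨w, hw⟩ := h.connected.exists_walk_length_eq_dist q x
  obtain ⟨w', hw'⟩ := h.connected.exists_walk_length_eq_dist r x
  have h1 := h.dist_eq_of_mem_half hq hxq
  have h2 := h.dist_eq_of_mem_half hr hxr
  have e1 : (Walk.cons hq w).IsPath := Walk.isPath_of_length_eq_dist _ (by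
    rw [Walk.length_cons, hw, dist_comm, ← h1, dist_comm])
  have e2 : (Walk.cons hr w').IsPath := Walk.isPath_of_length_eq_dist _ (by
    rw [Walk.length_cons, hw', dist_comm, ← h2, dist_comm])
  have h3 := congrArg (fun w => w.1.snd) ((h.isAcyclic.subsingleton_path p x).elim ⟨_, e1⟩ ⟨_, e2⟩)
  simpa using h3

/-- Only the edge `{p, q}` joins the two sides of that edge. -/
theorem IsTree.eq_of_adj_of_mem_half (h : Γ.IsTree) {p q x y : V} (hpq : Γ.Adj p q)
    (hxy : Γ.Adj x y) (hx : x ∈ Γ.half p q) (hy : y ∉ Γ.half p q) : x = q ∧ y = p := by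
  have key : ∀ {p q x y : V}, Γ.Adj p q → Γ.Adj x y → x ∈ Γ.half p q → y ∈ Γ.half q p → y = p := by
    intro p q x y hpq hxy hx hy
    by_contra hne
    obtain ⟨y', hy', hp⟩ := h.exists_mem_half (p := y) (x := p) (Ne.symm hne)
    have a1 := h.dist_eq_of_mem_half hpq hx
    have a2 := h.dist_eq_of_mem_half hpq.symm hy
    have a3 := h.dist_eq_of_mem_half hy' hp
    have b1 := h.dist_eq_dist_add_one_of_adj q hxy
    have b2 := h.dist_eq_dist_add_one_of_adj p hxy
    have b3 := h.dist_eq_dist_add_one_of_adj q hy'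
    have b4 := h.dist_eq_dist_add_one_of_adj y' hpq
    rw [dist_comm (u := x), dist_comm (u := x)] at a1
    rw [dist_comm (u := y), dist_comm (u := y)] at a2
    rw [dist_comm (u := y'), dist_comm (u := y')] at b4
    have : x = y' := h.eq_of_mem_half (x := q) hxy.symm hy'
      (by rw [mem_half]; omega) (by rw [mem_half]; omega)
    subst this
    omega
  have hy' := (h.notMem_half hpq).1 hy
  exact ⟨key hpq.symm hxy.symm hy' hx, key hpq hxy hx hy'⟩

/-- The path between points on different sides of the edge `{p, q}` runs through `p`. -/
theorem IsTree.dist_eq_add_of_mem_half (h : Γ.IsTree) {p q x y : V} (hpq : Γ.Adj p q)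
    (hx : x ∈ Γ.half p q) (hy : y ∉ Γ.half p q) : Γ.dist x y = Γ.dist x p + Γ.dist p y := by
  classical
  obtain ⟨w, hw⟩ := h.connected.exists_walk_length_eq_dist x y
  obtain ⟨d, hd, hd1, hd2⟩ := w.exists_boundary_dart _ hx hy
  obtain ⟨-, h2⟩ := h.eq_of_adj_of_mem_half hpq d.adj hd1 hd2
  have hp : p ∈ w.support := h2 ▸ w.dart_snd_mem_support_of_mem_darts hd
  have h3 := congrArg Walk.length (w.take_spec hp)
  rw [Walk.length_append] at h3
  have := dist_le (w.takeUntil p hp)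
  have := dist_le (w.dropUntil p hp)
  have := h.connected.dist_triangle (u := x) (v := p) (w := y)
  omega

theorem IsTree.half_subset_half (h : Γ.IsTree) {p q a b : V} (hpq : Γ.Adj p q) (hab : Γ.Adj a b)
    (hq : q ∈ Γ.half a b) (ha : a ∉ Γ.half p q) : Γ.half p q ⊆ Γ.half a b := by
  intro x hx
  by_contra hxa
  have h1 := h.dist_eq_add_of_mem_half hab hq hxa
  have h2 := h.dist_eq_add_of_mem_half hpq hx ha
  have h3 := h.dist_eq_of_mem_half hpq hx
  have h4 := h.connected.dist_triangle (u := q) (v := p) (w := a)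
  have h5 : Γ.dist q p = 1 := dist_eq_one_iff_adj.2 hpq.symm
  have h6 := h.connected.dist_triangle (u := x) (v := q) (w := a)
  have h7 : q ≠ a := fun h => ha (h ▸ hpq.right_mem_half)
  have h8 := h.connected.pos_dist_of_ne h7
  rw [dist_comm (u := q) (v := x), dist_comm (u := a) (v := x)] at h1
  omega

/-- A nonempty set of vertices of a tree is connected if it contains the first vertex of the path
between any two of its points. -/
theorem IsTree.induce_connected (h : Γ.IsTree) {S : Set V} (hS : S.Nonempty)
    (hstep : ∀ x ∈ S, ∀ y ∈ S, ∀ r, Γ.Adj x r → y ∈ Γ.half x r → r ∈ S) :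
    (Γ.induce S).Connected := by
  have : Nonempty S := hS.to_subtype
  refine ⟨fun x y => ?_⟩
  induction hn : Γ.dist (y : V) x using Nat.strong_induction_on generalizing x with
  | _ n ih =>
  by_cases hxy : (y : V) = x
  · rw [Subtype.ext hxy]
  · obtain ⟨r, hr, hy⟩ := h.exists_mem_half hxy
    have hrS := hstep x x.2 y y.2 r hr hy
    refine Reachable.trans (Adj.reachable ?_) (ih _ (hn ▸ hy) ⟨r, hrS⟩ rfl)
    exact hr

/-- A complement of a union of halves is convex. -/
theorem IsTree.induce_connected_of_halves (h : Γ.IsTree) {S : Set V} (hS : S.Nonempty)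
    {E : Set (V × V)} (hE : ∀ e ∈ E, Γ.Adj e.1 e.2) (hSE : ∀ x, x ∈ S ↔ ∀ e ∈ E, x ∉ Γ.half e.1 e.2) :
    (Γ.induce S).Connected := by
  refine h.induce_connected hS fun x hx y hy r hr hyr => (hSE r).2 fun e he hre => ?_
  obtain ⟨h1, h2⟩ := h.eq_of_adj_of_mem_half (hE e he) hr.symm hre ((hSE x).1 hx e he)
  rw [h1, h2] at hyr
  exact (hSE y).1 hy e he hyr

end SimpleGraph

section Cosets

variable {G : Type*} [Group G]

theorem infinite_cosetOf {x : G} {H : Subgroup G} :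
    (cosetOf x H).Infinite ↔ (H : Set G).Infinite :=
  not_congr ⟨fun h => Set.Finite.of_preimage (f := fun g => x⁻¹ * g) h (Equiv.mulLeft x⁻¹).surjective,
    fun h => h.preimage (f := fun g => x⁻¹ * g) (mul_right_injective x⁻¹).injOn⟩

theorem AlmostInvariant.finite_inter_mul_right {A Y : Set G} (hA : AlmostInvariant A) (k : G) :
    ({g | g * k ∈ Y} ∩ A).Finite ↔ (Y ∩ A).Finite := by
  have h1 : ({g | g * k ∈ Y} ∩ A).Finite ↔ ({g | g * k ∈ Y} ∩ {g | g * k ∈ A}).Finite := by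
    constructor
    all_goals
      refine fun h => (h.union (hA k)).subset fun g hg => ?_
      have := hg.1
      have := hg.2
      simp only [Set.mem_union, Set.mem_inter_iff, mem_rightBoundary, Set.mem_ofPred_eq] at *
      tauto
  rw [h1]
  exact ⟨fun h => Set.Finite.of_preimage (f := fun g => g * k) (s := Y ∩ A) h
    (Equiv.mulRight k).surjective,
    fun h => h.preimage (f := fun g => g * k) (mul_left_injective k).injOn⟩

/-- An almost invariant set is constant on all but finitely many left cosets of a finitely generated
subgroup. -/
theorem AlmostInvariant.finite_nonconstant_cosets {A : Set G} (hA : AlmostInvariant A)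
    {H : Subgroup G} (hH : H.FG) :
    {Y | (∃ x, Y = cosetOf x H) ∧ (Y ∩ A).Nonempty ∧ (Y \ A).Nonempty}.Finite := by
  obtain ⟨S, rfl⟩ := hH
  refine (((S.finite_toSet.biUnion fun s _ => hA s)).image
    fun g => cosetOf g (Subgroup.closure (S : Set G))).subset ?_
  rintro _ ⟨⟨x, rfl⟩, ⟨a, ha, haA⟩, ⟨b, hb, hbA⟩⟩
  by_contra hne
  have h1 : ∀ s ∈ S, ∀ g ∈ cosetOf x (Subgroup.closure (S : Set G)), (g ∈ A ↔ g * s ∈ A) := by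
    intro s hs g hg
    by_contra h
    exact hne ⟨g, Set.mem_biUnion hs h, cosetOf_eq hg⟩
  have h2 : ∀ k ∈ Subgroup.closure (S : Set G), ∀ g ∈ cosetOf x (Subgroup.closure (S : Set G)),
      (g ∈ A ↔ g * k ∈ A) := by
    have hmul : ∀ k ∈ Subgroup.closure (S : Set G), ∀ g ∈ cosetOf x (Subgroup.closure (S : Set G)),
        g * k ∈ cosetOf x (Subgroup.closure (S : Set G)) := by
      intro k hk g hg
      rw [mem_cosetOf, ← mul_assoc]
      exact mul_mem hg hk
    intro k hk
    induction hk using Subgroup.closure_induction with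
    | mem s hs => exact h1 s hs
    | one => simp
    | mul k l hk _ ih1 ih2 =>
      intro g hg
      rw [ih1 g hg, ih2 _ (hmul k hk g hg), mul_assoc]
    | inv k hk ih =>
      intro g hg
      rw [ih _ (hmul _ (inv_mem hk) g hg), inv_mul_cancel_right]
  have h3 := h2 (a⁻¹ * b) (by
    have := mul_mem (inv_mem (mem_cosetOf.1 ha)) (mem_cosetOf.1 hb)
    simpa [mul_assoc] using this) a ha
  rw [mul_inv_cancel_left] at h3
  exact hbA (h3.1 haA)

theorem AlmostInvariant.finite_splitCosets {A : Set G} (hA : AlmostInvariant A)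
    {H : Subgroup G} (hH : H.FG) : (splitCosets A H).Finite :=
  (hA.finite_nonconstant_cosets hH).subset fun _ hY => ⟨hY.1, hY.2.1.nonempty, hY.2.2.nonempty⟩

theorem AlmostInvariant.finite_ne_color {A : Set G} (hA : AlmostInvariant A)
    {H : Subgroup G} (hH : H.FG) (hinf : (H : Set G).Infinite) :
    {g | ¬Splits A (cosetOf g H) ∧ ¬(g ∈ A ↔ (cosetOf g H ∩ A).Infinite)}.Finite := by
  refine ((hA.finite_nonconstant_cosets hH).biUnion
    (t := fun Y => {g ∈ Y | ¬Splits A Y ∧ ¬(g ∈ A ↔ (Y ∩ A).Infinite)}) fun Y _ => ?_).subset ?_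
  · by_cases hs : Splits A Y
    · simp [hs]
    by_cases hi : (Y ∩ A).Infinite
    · refine ((not_splits.1 hs).resolve_left hi).subset fun g hg => ⟨hg.1, fun hgA => hg.2.2 ?_⟩
      simp [hgA, hi]
    · refine (Set.not_infinite.1 hi).subset fun g hg => ⟨hg.1, ?_⟩
      have := hg.2.2
      tauto
  · rintro g ⟨hs, hg⟩
    refine Set.mem_biUnion (x := cosetOf g H) ⟨⟨g, rfl⟩, ?_⟩ ⟨self_mem_cosetOf g H, hs, hg⟩
    by_cases hgA : g ∈ A
    · refine ⟨⟨g, self_mem_cosetOf g H, hgA⟩, ?_⟩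
      by_contra hne
      rw [Set.not_nonempty_iff_eq_empty, Set.sdiff_eq_empty] at hne
      rw [Set.inter_eq_left.2 hne, infinite_cosetOf] at hg
      tauto
    · refine ⟨?_, ⟨g, self_mem_cosetOf g H, hgA⟩⟩
      by_contra hne
      rw [Set.not_nonempty_iff_eq_empty] at hne
      simp [hne, hgA] at hg

end Cosets

namespace SimpleGraph

variable {V : Type*} {Γ : SimpleGraph V}

theorem IsTree.mem_half_of_walk (h : Γ.IsTree) {v q x y : V} (hq : Γ.Adj v q) (w : Γ.Walk x y)
    (hw : v ∉ w.support) (hx : x ∈ Γ.half v q) : y ∈ Γ.half v q := by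
  by_contra hy
  obtain ⟨d, hd, hd1, hd2⟩ := w.exists_boundary_dart _ hx hy
  obtain ⟨-, h2⟩ := h.eq_of_adj_of_mem_half hq d.adj hd1 hd2
  exact hw (h2 ▸ w.dart_snd_mem_support_of_mem_darts hd)

end SimpleGraph

namespace TreeAction

open MulAction SimpleGraph

variable {G : Type*} [Group G] {V : Type*} {Γ : SimpleGraph V} [MulAction G V]

/-- An element acting as a graph homomorphism. -/
def smulHom (hadj : ∀ (g : G) (u v : V), Γ.Adj u v → Γ.Adj (g • u) (g • v)) (g : G) : Γ →g Γ where
  toFun x := g • x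
  map_rel' h := hadj g _ _ h

theorem dist_smul (hc : Γ.Connected) (hadj : ∀ (g : G) (u v : V), Γ.Adj u v → Γ.Adj (g • u) (g • v))
    (g : G) (x y : V) : Γ.dist (g • x) (g • y) = Γ.dist x y := by
  have key : ∀ (g : G) (x y : V), Γ.dist (g • x) (g • y) ≤ Γ.dist x y := by
    intro g x y
    obtain ⟨w, hw⟩ := hc.exists_walk_length_eq_dist x y
    rw [← hw, ← Walk.length_map (smulHom hadj g) w]
    exact dist_le _
  refine (key g x y).antisymm ?_
  simpa using key g⁻¹ (g • x) (g • y)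

theorem smul_mem_half_smul (hc : Γ.Connected)
    (hadj : ∀ (g : G) (u v : V), Γ.Adj u v → Γ.Adj (g • u) (g • v)) {g : G} {p q x : V} :
    g • x ∈ Γ.half (g • p) (g • q) ↔ x ∈ Γ.half p q := by
  simp only [mem_half, dist_smul hc hadj]

theorem mem_half_smul (hc : Γ.Connected)
    (hadj : ∀ (g : G) (u v : V), Γ.Adj u v → Γ.Adj (g • u) (g • v)) {g : G} {p q x : V} :
    x ∈ Γ.half (g • p) (g • q) ↔ g⁻¹ • x ∈ Γ.half p q := by
  rw [← smul_mem_half_smul hc hadj (g := g) (x := g⁻¹ • x), smul_inv_smul]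

/-- If a finitely generated group acts on a tree with finitely generated edge stabilizers, then the
vertex stabilizers are finitely generated. -/
theorem fg_stabilizer [Group.FG G] (h : Γ.IsTree)
    (hadj : ∀ (g : G) (u v : V), Γ.Adj u v → Γ.Adj (g • u) (g • v)) (w : V)
    (hE : ∀ q, Γ.Adj w q → (stabilizer G w ⊓ stabilizer G q).FG) : (stabilizer G w).FG := by
  classical
  obtain ⟨S, hS⟩ := (Group.fg_def (G := G)).1 inferInstance
  have hf : ∀ x : V, ∃ q, x ≠ w → Γ.Adj w q ∧ x ∈ Γ.half w q := fun x => by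
    by_cases hx : x = w
    · exact ⟨w, fun h => absurd hx h⟩
    · obtain ⟨q, hq⟩ := h.exists_mem_half hx
      exact ⟨q, fun _ => hq⟩
  choose f hf using hf
  have hfs : ∀ g ∈ stabilizer G w, ∀ x ≠ w, g • x ≠ w ∧ f (g • x) = g • f x := by
    intro g hg x hx
    have hgx : g • x ≠ w := fun e => hx (by
      rw [← inv_smul_smul g x, e]
      exact mem_stabilizer_iff.1 (inv_mem hg))
    have h1 := hadj g _ _ (hf x hx).1
    have h2 := (smul_mem_half_smul h.connected hadj (g := g)).2 (hf x hx).2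
    rw [mem_stabilizer_iff.1 hg] at h1 h2
    exact ⟨hgx, h.eq_of_mem_half (hf _ hgx).1 h1 (hf _ hgx).2 h2⟩
  have hk : ∀ p : V, ∃ k : G, (∃ g : G, g • p = w) → k • p = w := fun p => by
    by_cases hp : ∃ g : G, g • p = w
    · obtain ⟨g, hg⟩ := hp; exact ⟨g, fun _ => hg⟩
    · exact ⟨1, fun h => absurd h hp⟩
  choose k hk using hk
  have hW : ∀ s : G, Nonempty (Γ.Walk w (s • w)) := fun s => h.connected w (s • w)
  let W : ∀ s : G, Γ.Walk w (s • w) := fun s => (hW s).some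
  set X : Set G := ⋃ s ∈ S, ⋃ p ∈ {p | p ∈ (W s).support}, {k p, k p * s} with hX
  have hXf : X.Finite := S.finite_toSet.biUnion fun s _ =>
    (List.finite_toSet (W s).support).biUnion fun p _ => Set.toFinite _
  set Q : Set V := (fun k : G => f (k • w)) '' {k ∈ X | k • w ≠ w} with hQ
  have hQf : Q.Finite := (hXf.subset (Set.sep_subset _ _)).image _
  have hQw : ∀ q ∈ Q, Γ.Adj w q := by
    rintro _ ⟨k, hk, rfl⟩
    exact (hf _ hk.2).1
  have hT : ∀ qq : V × V, ∃ T : Set G, T.Finite ∧ (T ⊆ stabilizer G w) ∧ (qq.1 ∈ Q →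
      ∀ g ∈ stabilizer G w, g • qq.1 = qq.2 → g ∈ Subgroup.closure T) := by
    rintro ⟨q, q'⟩
    by_cases hq : q ∈ Q
    · by_cases hg : ∃ g ∈ stabilizer G w, g • q = q'
      · obtain ⟨g, hg, hgq⟩ := hg
        obtain ⟨T, hT⟩ := hE q (hQw q hq)
        refine ⟨insert g T, T.finite_toSet.insert g, ?_, ?_⟩
        · refine Set.insert_subset hg fun t ht => ?_
          have : t ∈ stabilizer G w ⊓ stabilizer G q := hT ▸ Subgroup.subset_closure ht
          exact this.1
        · intro _ g' hg' hgq'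
          have h1 : g⁻¹ * g' ∈ stabilizer G w ⊓ stabilizer G q := by
            refine Subgroup.mem_inf.2 ⟨mul_mem (inv_mem hg) hg', ?_⟩
            simp only at hgq hgq'
            change (g⁻¹ * g') • q = q
            rw [mul_smul, hgq', ← hgq, inv_smul_smul]
          rw [← hT] at h1
          have h2 := mul_mem (Subgroup.subset_closure (Set.mem_insert g (T : Set G)))
            (Subgroup.closure_mono (Set.subset_insert g (T : Set G)) h1)
          rwa [mul_inv_cancel_left] at h2
      · exact ⟨∅, Set.finite_empty, Set.empty_subset _, fun _ g h1 h2 => absurd ⟨g, h1, h2⟩ hg⟩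
    · exact ⟨∅, Set.finite_empty, Set.empty_subset _, fun h => absurd h hq⟩
  choose T hTf hTs hT using hT
  set R : Set G := (X ∩ stabilizer G w) ∪ ⋃ qq ∈ Q ×ˢ Q, T qq with hR
  have hRf : R.Finite := (hXf.inter_of_left _).union ((hQf.prod hQf).biUnion fun qq _ => hTf qq)
  set L := Subgroup.closure R with hL
  suffices hLw : stabilizer G w = L by
    rw [hLw]; exact (Subgroup.fg_iff _).2 ⟨R, rfl, hRf⟩
  have hLle : L ≤ stabilizer G w := by
    rw [hL, Subgroup.closure_le]
    refine Set.union_subset Set.inter_subset_right (Set.iUnion₂_subset fun qq _ => hTs qq)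
  refine le_antisymm ?_ hLle
  set P : Set G := {g | (g • w = w ∧ g ∈ L) ∨ (g • w ≠ w ∧ ∃ l ∈ L, ∃ q ∈ Q, f (g • w) = l • q)}
    with hP
  have hXP : ∀ x ∈ X, ∀ g ∈ stabilizer G w, g * x ∈ P ↔ g ∈ L := by
    intro x hx g hg
    by_cases hxw : x • w = w
    · have hxL : x ∈ L := Subgroup.subset_closure (Or.inl ⟨hx, hxw⟩)
      have hgx : (g * x) • w = w := by rw [mul_smul, hxw]; exact hg
      simp [hP, hgx, Subgroup.mul_mem_cancel_right _ hxL]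
    · obtain ⟨h1, h2⟩ := hfs g hg _ hxw
      rw [← mul_smul] at h1 h2
      have hxQ : f (x • w) ∈ Q := ⟨x, ⟨hx, hxw⟩, rfl⟩
      simp only [hP, Set.mem_ofPred_eq, h1, false_and, false_or, ne_eq, not_false_eq_true, true_and,
        h2]
      constructor
      · rintro ⟨l, hl, q, hq, e⟩
        have h3 := hT (f (x • w), q) hxQ (l⁻¹ * g) (mul_mem (inv_mem (hLle hl)) hg)
          (by simp only; rw [mul_smul, e, inv_smul_smul])
        have h4 : l⁻¹ * g ∈ L := Subgroup.closure_mono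
          ((Set.subset_biUnion_of_mem (u := T) (Set.mk_mem_prod hxQ hq)).trans
            Set.subset_union_right) h3
        have := mul_mem hl h4
        rwa [mul_inv_cancel_left] at this
      · exact fun hgL => ⟨g, hgL, _, hxQ, rfl⟩
  have hstep : ∀ s ∈ S, ∀ g, g ∈ P ↔ g * s ∈ P := by
    intro s hs g
    by_cases hp : ∃ p ∈ (W s).support, g • p = w
    · obtain ⟨p, hp, hgp⟩ := hp
      have h1 := hk p ⟨g, hgp⟩
      have h2 : g * (k p)⁻¹ ∈ stabilizer G w := by
        rw [mem_stabilizer_iff, mul_smul, ← hgp, ← h1.trans hgp.symm, inv_smul_smul, h1, hgp]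
      have h3 : k p ∈ X := Set.mem_biUnion hs (Set.mem_biUnion hp (Or.inl rfl))
      have h4 : k p * s ∈ X := Set.mem_biUnion hs (Set.mem_biUnion hp (Or.inr rfl))
      have h5 := (hXP _ h3 _ h2).trans (hXP _ h4 _ h2).symm
      rwa [inv_mul_cancel_right, ← mul_assoc, inv_mul_cancel_right] at h5
    · push Not at hp
      have h1 := hp _ (W s).start_mem_support
      have h2 := hp _ (W s).end_mem_support
      have h3 := h.mem_half_of_walk (hf _ h1).1 ((W s).map (smulHom hadj g)) (by
        rw [Walk.support_map]
        intro hm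
        obtain ⟨p, hp', e⟩ := List.mem_map.1 hm
        exact hp p hp' e) (hf _ h1).2
      have h4 := h.eq_of_mem_half (hf _ h1).1 (hf _ h2).1 h3 (hf _ h2).2
      rw [← mul_smul] at h2 h4
      simp only [hP, Set.mem_ofPred_eq, h4, ne_eq, h1, h2, false_and, not_false_eq_true]
  have hall : ∀ x g : G, g ∈ P ↔ g * x ∈ P := by
    intro x
    have hx : x ∈ Subgroup.closure (S : Set G) := hS ▸ Subgroup.mem_top x
    induction hx using Subgroup.closure_induction with
    | mem s hs => exact hstep s hs
    | one => simp
    | mul x y _ _ ih1 ih2 => intro g; rw [ih1 g, ih2, mul_assoc]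
    | inv x _ ih => intro g; rw [ih (g * x⁻¹), inv_mul_cancel_right]
  intro g hg
  have h1 : g ∈ P := by
    have := (hall g 1).1 (Or.inl ⟨one_smul G w, one_mem L⟩)
    rwa [one_mul] at this
  exact (h1.resolve_right fun h => h.1 hg).2

theorem exists_smul_mem_half (h : Γ.IsTree)
    (hadj : ∀ (g : G) (u v : V), Γ.Adj u v → Γ.Adj (g • u) (g • v))
    (hmin : ∀ S : Set V, S.Nonempty → (∀ g : G, ∀ x ∈ S, g • x ∈ S) →
      (Γ.induce S).Connected → S = Set.univ) (x : V) {p q : V} (hpq : Γ.Adj p q) :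
    ∃ g : G, g • x ∈ Γ.half p q := by
  by_contra! hx
  have h1 := hmin {y | ∀ g : G, g • y ∉ Γ.half p q} ⟨x, hx⟩
    (fun g y hy k => by rw [← mul_smul]; exact hy _)
    (h.induce_connected_of_halves ⟨x, hx⟩ (E := Set.range fun g : G => (g • p, g • q))
      (by rintro _ ⟨g, rfl⟩; exact hadj g _ _ hpq) fun y => by
        rw [Set.forall_mem_range]
        simp only [mem_half_smul h.connected hadj]
        exact ⟨fun hy g => hy g⁻¹, fun hy g => by simpa using hy g⁻¹⟩)
  have h2 : q ∈ {y | ∀ g : G, g • y ∉ Γ.half p q} := h1 ▸ Set.mem_univ q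
  have h3 := h2 1
  rw [one_smul] at h3
  exact h3 hpq.right_mem_half

/-- A minimal tree has no leaf. -/
theorem exists_adj_ne (h : Γ.IsTree)
    (hadj : ∀ (g : G) (u v : V), Γ.Adj u v → Γ.Adj (g • u) (g • v))
    (hninv : ∀ (g : G) (u v : V), Γ.Adj u v → ¬(g • u = v ∧ g • v = u))
    (hmin : ∀ S : Set V, S.Nonempty → (∀ g : G, ∀ x ∈ S, g • x ∈ S) →
      (Γ.induce S).Connected → S = Set.univ) {u p : V} (hup : Γ.Adj u p) :
    ∃ r, Γ.Adj u r ∧ r ≠ p := by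
  by_contra! hr
  have hp : p ∈ {x | ∀ g : G, g • x ≠ u} := by
    intro g hg
    have h1 := hadj g _ _ hup.symm
    rw [hg] at h1
    exact hninv g _ _ hup ⟨hr _ h1, hg⟩
  have h1 := hmin {x | ∀ g : G, g • x ≠ u} ⟨p, hp⟩
    (fun g y hy k => by rw [← mul_smul]; exact hy _)
    (h.induce_connected ⟨p, hp⟩ fun x hx y hy r hxr hyr g hg => by
      have hyr' : y ≠ r := fun e => hy g (e ▸ hg)
      obtain ⟨r', h2, h3⟩ := h.exists_mem_half hyr'
      have h4 := hadj g _ _ h2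
      have h5 := hadj g _ _ hxr.symm
      rw [hg] at h4 h5
      have h6 : r' = x := smul_left_cancel g ((hr _ h4).trans (hr _ h5).symm)
      subst h6
      exact (h.notMem_half h2).2 hyr h3)
  have h2 : u ∈ {x | ∀ g : G, g • x ≠ u} := h1 ▸ Set.mem_univ u
  exact h2 1 (one_smul G u)

/-- A finitely generated group acting minimally on a tree has finitely many orbits of edges. -/
theorem exists_finite_edges [Group.FG G] (h : Γ.IsTree)
    (hadj : ∀ (g : G) (u v : V), Γ.Adj u v → Γ.Adj (g • u) (g • v))
    (hmin : ∀ S : Set V, S.Nonempty → (∀ g : G, ∀ x ∈ S, g • x ∈ S) →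
      (Γ.induce S).Connected → S = Set.univ) :
    ∃ D : Set (V × V), D.Finite ∧ ∀ p q, Γ.Adj p q → ∃ g : G, ∃ d ∈ D, Γ.Adj d.1 d.2 ∧
      g • d.1 = p ∧ g • d.2 = q := by
  classical
  obtain ⟨S, hS⟩ := (Group.fg_def (G := G)).1 inferInstance
  obtain ⟨x⟩ := h.connected.nonempty
  let W : ∀ s : G, Γ.Walk x (s • x) := fun s => (h.connected x (s • x)).some
  have hD : (⋃ s ∈ S, {d : V × V | d.1 ∈ (W s).support ∧ d.2 ∈ (W s).support}).Finite :=
    S.finite_toSet.biUnion fun s _ =>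
      (List.finite_toSet (W s).support).prod (List.finite_toSet (W s).support)
  refine ⟨_, hD, fun p q hpq => ?_⟩
  by_contra! hno
  have hstep : ∀ s ∈ S, ∀ g : G, g • x ∈ Γ.half p q ↔ (g * s) • x ∈ Γ.half p q := by
    have key : ∀ s ∈ S, ∀ g : G, ∀ {a b y z : V} (w : Γ.Walk y z),
        (∀ v ∈ w.support, v ∈ (W s).support) →
        (∀ g : G, ∀ d ∈ ⋃ s ∈ S, {d : V × V | d.1 ∈ (W s).support ∧ d.2 ∈ (W s).support},
          Γ.Adj d.1 d.2 → g • d.1 = a → g • d.2 ≠ b) → Γ.Adj a b →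
        g • y ∈ Γ.half a b → g • z ∈ Γ.half a b := by
      intro s hs g a b y z w hw hno hab hy
      by_contra hz
      obtain ⟨d, hd, hd1, hd2⟩ := w.exists_boundary_dart {v | g • v ∈ Γ.half a b} hy hz
      obtain ⟨h1, h2⟩ := h.eq_of_adj_of_mem_half hab (hadj g _ _ d.adj) hd1 hd2
      exact hno g (d.snd, d.fst) (Set.mem_biUnion hs
        ⟨hw _ (w.dart_snd_mem_support_of_mem_darts hd),
          hw _ (w.dart_fst_mem_support_of_mem_darts hd)⟩) d.adj.symm h2 h1
    intro s hs g
    rw [mul_smul]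
    exact ⟨key s hs g (W s) (fun _ h => h) hno hpq,
      key s hs g (W s).reverse (fun v hv => by rwa [Walk.support_reverse, List.mem_reverse] at hv)
        hno hpq⟩
  have hall : ∀ s g : G, g • x ∈ Γ.half p q ↔ (g * s) • x ∈ Γ.half p q := by
    intro s
    have hs : s ∈ Subgroup.closure (S : Set G) := hS ▸ Subgroup.mem_top s
    induction hs using Subgroup.closure_induction with
    | mem s hs => exact hstep s hs
    | one => simp
    | mul a b _ _ ih1 ih2 => intro g; rw [ih1 g, ih2, mul_assoc]
    | inv a _ ih => intro g; rw [ih (g * a⁻¹), inv_mul_cancel_right]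
  obtain ⟨g, hg⟩ := exists_smul_mem_half h hadj hmin x hpq
  obtain ⟨k, hk⟩ := exists_smul_mem_half h hadj hmin x hpq.symm
  have h1 := (hall (g⁻¹ * k) g).1 hg
  rw [mul_inv_cancel_left] at h1
  exact (h.notMem_half hpq).2 hk h1

theorem finite_setOf_smul_eq {a b x y : V}
    (hfin : ((stabilizer G a ⊓ stabilizer G b : Subgroup G) : Set G).Finite) :
    {g : G | g • x = a ∧ g • y = b}.Finite := by
  rcases Set.eq_empty_or_nonempty {g : G | g • x = a ∧ g • y = b} with h | ⟨k, rfl, rfl⟩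
  · simp [h]
  · refine (hfin.preimage (f := fun g => g * k⁻¹) (mul_left_injective k⁻¹).injOn).subset
      fun g hg => Subgroup.mem_inf.2 ⟨?_, ?_⟩
    · rw [mem_stabilizer_iff, mul_smul, inv_smul_smul]; exact hg.1
    · rw [mem_stabilizer_iff, mul_smul, inv_smul_smul]; exact hg.2

theorem finite_setOf_half_ne (h : Γ.IsTree)
    (hadj : ∀ (g : G) (u v : V), Γ.Adj u v → Γ.Adj (g • u) (g • v)) {p q : V} (hpq : Γ.Adj p q)
    (hfin : ((stabilizer G p ⊓ stabilizer G q : Subgroup G) : Set G).Finite) (x y : V) :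
    {g : G | ¬(g • x ∈ Γ.half p q ↔ g • y ∈ Γ.half p q)}.Finite := by
  obtain ⟨w⟩ := h.connected x y
  induction w with
  | nil => simp
  | @cons x z y hxz w ih =>
    have h1 : {g : G | ¬(g • x ∈ Γ.half p q ↔ g • z ∈ Γ.half p q)}.Finite := by
      refine ((finite_setOf_smul_eq (x := x) (y := z) hfin).union
        (finite_setOf_smul_eq (x := z) (y := x) hfin)).subset fun g hg => ?_
      by_cases hx : g • x ∈ Γ.half p q
      · have hz : g • z ∉ Γ.half p q := fun hz => hg (by tauto)
        obtain ⟨h1, h2⟩ := h.eq_of_adj_of_mem_half hpq (hadj g _ _ hxz) hx hz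
        exact Or.inr ⟨h2, h1⟩
      · have hz : g • z ∈ Γ.half p q := by_contra fun hz => hg (by tauto)
        obtain ⟨h1, h2⟩ := h.eq_of_adj_of_mem_half hpq (hadj g _ _ hxz.symm) hz hx
        exact Or.inl ⟨h2, h1⟩
    refine (h1.union ih).subset fun g hg => ?_
    simp only [Set.mem_union, Set.mem_ofPred_eq] at *
    tauto

theorem infinite_setOf_smul_mem_half [Infinite G] (h : Γ.IsTree)
    (hadj : ∀ (g : G) (u v : V), Γ.Adj u v → Γ.Adj (g • u) (g • v))
    (hninv : ∀ (g : G) (u v : V), Γ.Adj u v → ¬(g • u = v ∧ g • v = u))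
    (hmin : ∀ S : Set V, S.Nonempty → (∀ g : G, ∀ x ∈ S, g • x ∈ S) →
      (Γ.induce S).Connected → S = Set.univ) {p q : V} (hpq : Γ.Adj p q) :
    {g : G | g • p ∈ Γ.half p q}.Infinite := by
  intro hfin
  obtain ⟨g, hg⟩ := exists_smul_mem_half h hadj hmin p hpq
  have hkpq := hadj g⁻¹ _ _ hpq
  have hp : p ∈ Γ.half (g⁻¹ • p) (g⁻¹ • q) := by
    rw [mem_half_smul h.connected hadj, inv_inv]; exact hg
  have hq : q ∈ Γ.half (g⁻¹ • p) (g⁻¹ • q) := by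
    by_contra hq
    obtain ⟨h1, h2⟩ := h.eq_of_adj_of_mem_half hkpq hpq hp hq
    exact hninv g⁻¹ _ _ hpq ⟨h2.symm, h1.symm⟩
  by_cases hk : g⁻¹ • p ∈ Γ.half p q
  · have hsub := h.half_subset_half hpq.symm hkpq hp
      (fun h' => (h.notMem_half hpq.symm).2 hk h')
    refine Set.infinite_univ (α := G) ((hfin.union
      (hfin.preimage (f := fun k => g * k) (mul_right_injective g).injOn)).subset fun k _ => ?_)
    by_cases hkp : k • p ∈ Γ.half p q
    · exact Or.inl hkp
    · have := hsub ((h.notMem_half hpq).1 hkp)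
      rw [mem_half_smul h.connected hadj, inv_inv, ← mul_smul] at this
      exact Or.inr this
  · have hsub := h.half_subset_half hpq hkpq hq hk
    have hsub' : ∀ x ∈ Γ.half p q, g • x ∈ Γ.half p q := fun x hx => by
      have := hsub hx
      rwa [mem_half_smul h.connected hadj, inv_inv] at this
    have hpow : ∀ n : ℕ, g ^ (n + 1) • p ∈ Γ.half p q := by
      intro n
      induction n with
      | zero => simpa using hg
      | succ n ih => rw [pow_succ', mul_smul]; exact hsub' _ ih
    refine Set.infinite_of_injective_forall_mem (f := fun n : ℕ => g ^ (n + 1)) ?_ hpow hfin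
    have hord : ¬IsOfFinOrder g := by
      intro ho
      obtain ⟨n, hn, hgn⟩ := isOfFinOrder_iff_pow_eq_one.1 ho
      have := hpow (n - 1)
      rw [Nat.sub_add_cancel hn, hgn, one_smul] at this
      exact left_notMem_half this
    exact fun m n hmn => by simpa using injective_pow_iff_not_isOfFinOrder.2 hord hmn

/-- An edge with finite stabilizer yields a nontrivial almost invariant set splitting no vertex
stabilizer. -/
theorem exists_almostInvariant_of_finite_edge [Infinite G] (h : Γ.IsTree)
    (hadj : ∀ (g : G) (u v : V), Γ.Adj u v → Γ.Adj (g • u) (g • v))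
    (hninv : ∀ (g : G) (u v : V), Γ.Adj u v → ¬(g • u = v ∧ g • v = u))
    (hmin : ∀ S : Set V, S.Nonempty → (∀ g : G, ∀ x ∈ S, g • x ∈ S) →
      (Γ.induce S).Connected → S = Set.univ) {p q : V} (hpq : Γ.Adj p q)
    (hfin : ((stabilizer G p ⊓ stabilizer G q : Subgroup G) : Set G).Finite) :
    ∃ A : Set G, AlmostInvariant A ∧ A.Infinite ∧ Aᶜ.Infinite ∧
      ∀ w : V, ¬Splits A (stabilizer G w) := by
  have hne := finite_setOf_half_ne h hadj hpq hfin
  refine ⟨{g | g • p ∈ Γ.half p q}, fun s => ?_,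
    infinite_setOf_smul_mem_half h hadj hninv hmin hpq, fun hf => ?_, fun w => ?_⟩
  · refine (hne p (s • p)).subset fun g hg => ?_
    simpa only [mem_rightBoundary, Set.mem_ofPred_eq, mul_smul] using hg
  · refine infinite_setOf_smul_mem_half h hadj hninv hmin hpq.symm
      ((hf.union (hne p q)).subset fun g hg => ?_)
    have h1 := (h.notMem_half hpq).2 hg
    by_cases h2 : g • p ∈ Γ.half p q
    · exact Or.inr fun h3 => h1 (h3.1 h2)
    · exact Or.inl h2
  · rw [splits_congr (A := {g : G | g • p ∈ Γ.half p q}) (B := {g : G | g • w ∈ Γ.half p q}) (hne p w)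
      fun g _ hg => not_not.1 hg,
      not_splits]
    by_cases hw : w ∈ Γ.half p q
    · right
      convert Set.finite_empty
      refine Set.sdiff_eq_empty.2 fun g hg => ?_
      rw [Set.mem_ofPred_eq, mem_stabilizer_iff.1 hg]; exact hw
    · left
      convert Set.finite_empty
      refine Set.eq_empty_of_forall_notMem fun g hg => hw ?_
      have := hg.2
      rwa [Set.mem_ofPred_eq, mem_stabilizer_iff.1 hg.1] at this

theorem setOf_mul_mem_cosetOf (g : G) (x y : V) :
    {h | h * g ∈ cosetOf g (stabilizer G x ⊓ stabilizer G y)} =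
      ((stabilizer G (g • x) ⊓ stabilizer G (g • y) : Subgroup G) : Set G) := by
  ext h
  simp only [Set.mem_ofPred_eq, mem_cosetOf, SetLike.mem_coe, Subgroup.mem_inf, mem_stabilizer_iff,
    mul_smul, inv_smul_eq_iff]

theorem setOf_mul_mem_cosetOf_stabilizer (g : G) (x : V) :
    {h | h * g ∈ cosetOf g (stabilizer G x)} = (stabilizer G (g • x) : Set G) := by
  ext h
  simp only [Set.mem_ofPred_eq, mem_cosetOf, SetLike.mem_coe, mem_stabilizer_iff, mul_smul,
    inv_smul_eq_iff]

theorem splits_cosetOf {A : Set G} (hA : AlmostInvariant A) (g : G) (x y : V) :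
    Splits A (cosetOf g (stabilizer G x ⊓ stabilizer G y)) ↔
      Splits A ((stabilizer G (g • x) ⊓ stabilizer G (g • y) : Subgroup G) : Set G) := by
  rw [← setOf_mul_mem_cosetOf, hA.splits_mul_right]

theorem splits_cosetOf_stabilizer {A : Set G} (hA : AlmostInvariant A) (g : G) (x : V) :
    Splits A (cosetOf g (stabilizer G x)) ↔ Splits A (stabilizer G (g • x) : Set G) := by
  rw [← setOf_mul_mem_cosetOf_stabilizer, hA.splits_mul_right]

theorem finite_ne_edge_color {A : Set G} (hA : AlmostInvariant A) {x y : V}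
    (hfg : (stabilizer G x ⊓ stabilizer G y).FG)
    (hinf : ((stabilizer G x ⊓ stabilizer G y : Subgroup G) : Set G).Infinite) :
    {g : G | ¬Splits A ((stabilizer G (g • x) ⊓ stabilizer G (g • y) : Subgroup G) : Set G) ∧
      ¬(g ∈ A ↔ (((stabilizer G (g • x) ⊓ stabilizer G (g • y) : Subgroup G) : Set G) ∩
        A).Infinite)}.Finite := by
  refine (hA.finite_ne_color hfg hinf).subset fun g hg => ?_
  rw [Set.mem_ofPred_eq, ← splits_cosetOf hA, ← setOf_mul_mem_cosetOf, Set.Infinite,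
    hA.finite_inter_mul_right] at hg
  exact hg

/-- If an almost invariant set splits the stabilizer of `v` but none of the (infinite) edge
stabilizers at `v`, then it can be modified so as to split only the stabilizer of `v`. -/
theorem exists_almostInvariant_splits_only (h : Γ.IsTree)
    (hadj : ∀ (g : G) (u v : V), Γ.Adj u v → Γ.Adj (g • u) (g • v))
    (hfg : ∀ p q, Γ.Adj p q → (stabilizer G p ⊓ stabilizer G q).FG)
    (hinf : ∀ p q, Γ.Adj p q → ((stabilizer G p ⊓ stabilizer G q : Subgroup G) : Set G).Infinite)
    {A : Set G} (hA : AlmostInvariant A) {v : V} (hv : Splits A (stabilizer G v))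
    (hE : ∀ q, Γ.Adj v q → ¬Splits A ((stabilizer G v ⊓ stabilizer G q : Subgroup G) : Set G)) :
    ∃ B : Set G, AlmostInvariant B ∧ B.Infinite ∧ Bᶜ.Infinite ∧
      ∀ w, w ≠ v → ¬Splits B (stabilizer G w) := by
  set χ : V → Prop :=
    fun q => (((stabilizer G v ⊓ stabilizer G q : Subgroup G) : Set G) ∩ A).Infinite with hχ
  set Φ : G → V → Prop :=
    fun g x => (x = v ∧ g ∈ A) ∨ ∃ q, Γ.Adj v q ∧ x ∈ Γ.half v q ∧ χ q with hΦ
  have hΦv : ∀ g, Φ g v ↔ g ∈ A := fun g => by simp [hΦ, left_notMem_half]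
  have hΦq : ∀ g q x, Γ.Adj v q → x ∈ Γ.half v q → (Φ g x ↔ χ q) := by
    intro g q x hq hx
    have hxv : x ≠ v := by rintro rfl; exact left_notMem_half hx
    simp only [hΦ, hxv, false_and, false_or]
    refine ⟨?_, fun h => ⟨q, hq, hx, h⟩⟩
    rintro ⟨q', hq', hx', h'⟩
    rwa [h.eq_of_mem_half hq hq' hx hx']
  have hkey : ∀ x y, Γ.Adj x y → ∀ g, g • x = v → ¬(Φ g (g • x) ↔ Φ g (g • y)) →
      g ∈ {g : G | ¬Splits A ((stabilizer G (g • x) ⊓ stabilizer G (g • y) : Subgroup G) : Set G) ∧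
      ¬(g ∈ A ↔ (((stabilizer G (g • x) ⊓ stabilizer G (g • y) : Subgroup G) : Set G) ∩
        A).Infinite)} := by
    intro x y hxy g hgx hg
    have h1 := hadj g _ _ hxy
    rw [hgx] at h1
    rw [hgx, hΦv, hΦq g _ _ h1 h1.right_mem_half] at hg
    simp only [Set.mem_ofPred_eq, hgx]
    exact ⟨hE _ h1, hg⟩
  have hfin : ∀ x y, {g : G | ¬(Φ g (g • x) ↔ Φ g (g • y))}.Finite := by
    intro x y
    obtain ⟨w⟩ := h.connected x y
    induction w with
    | nil => simp
    | @cons x z y hxz w ih =>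
      have h1 : {g : G | ¬(Φ g (g • x) ↔ Φ g (g • z))}.Finite := by
        refine ((finite_ne_edge_color hA (hfg _ _ hxz) (hinf _ _ hxz)).union
          (finite_ne_edge_color hA (hfg _ _ hxz.symm) (hinf _ _ hxz.symm))).subset fun g hg => ?_
        by_cases hx : g • x = v
        · exact Or.inl (hkey x z hxz g hx hg)
        by_cases hz : g • z = v
        · exact Or.inr (hkey z x hxz.symm g hz fun h' => hg h'.symm)
        obtain ⟨q, hq, hqx⟩ := h.exists_mem_half hx
        have hqz : g • z ∈ Γ.half v q := by
          by_contra hqz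
          exact hz (h.eq_of_adj_of_mem_half hq (hadj g _ _ hxz) hqx hqz).2
        refine absurd ?_ hg
        rw [hΦq g q _ hq hqx, hΦq g q _ hq hqz]
      refine (h1.union ih).subset fun g hg => ?_
      by_contra hne
      rw [Set.mem_union, not_or] at hne
      exact hg ((not_not.1 hne.1).trans (not_not.1 hne.2))
  have hB : ∀ g ∈ stabilizer G v, (Φ g (g • v) ↔ g ∈ A) := fun g hg => by
    rw [mem_stabilizer_iff.1 hg, hΦv]
  refine ⟨{g | Φ g (g • v)}, fun s => ?_, ?_, ?_, fun w hw => ?_⟩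
  · refine ((hfin v (s • v)).union (hA s)).subset fun g hg => ?_
    by_contra hne
    rw [Set.mem_union, not_or] at hne
    refine hg ((not_not.1 hne.1).trans ?_)
    have h1 : g ∈ A ↔ g * s ∈ A := not_not.1 hne.2
    simp only [Set.mem_ofPred_eq, mul_smul, hΦ, h1]
  · exact hv.1.mono fun g hg => (hB g hg.1).2 hg.2
  · exact hv.2.mono fun g hg => fun hg' => hg.2 ((hB g hg.1).1 hg')
  · obtain ⟨q, hq, hwq⟩ := h.exists_mem_half hw
    have hfix : ∀ g ∈ stabilizer G w, g ∈ stabilizer G v →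
        g ∈ stabilizer G v ⊓ stabilizer G q := by
      intro g hgw hgv
      refine Subgroup.mem_inf.2 ⟨hgv, ?_⟩
      have h1 := hadj g _ _ hq
      have h2 := (smul_mem_half_smul h.connected hadj (g := g)).2 hwq
      rw [mem_stabilizer_iff.1 hgv] at h1 h2
      rw [mem_stabilizer_iff.1 hgw] at h2
      exact h.eq_of_mem_half h1 hq h2 hwq
    have hmove : ∀ g ∈ stabilizer G w, g ∉ stabilizer G v → (Φ g (g • v) ↔ χ q) := by
      intro g hgw hgv
      refine hΦq g q _ hq ?_
      by_contra hgq
      have h1 := h.dist_eq_add_of_mem_half hq hwq hgq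
      have h2 := dist_smul h.connected hadj g w v
      rw [mem_stabilizer_iff.1 hgw] at h2
      have h3 := h.connected.pos_dist_of_ne (u := v) (v := g • v) fun e => hgv e.symm
      omega
    rw [not_splits]
    by_cases hc : χ q
    · right
      refine ((not_splits.1 (hE q hq)).resolve_left hc).subset fun g hg => ?_
      by_cases hgv : g ∈ stabilizer G v
      · exact ⟨hfix g hg.1 hgv, fun hgA => hg.2 ((hB g hgv).2 hgA)⟩
      · exact absurd ((hmove g hg.1 hgv).2 hc) hg.2
    · left
      refine (Set.not_infinite.1 hc).subset fun g hg => ?_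
      by_cases hgv : g ∈ stabilizer G v
      · exact ⟨hfix g hg.1 hgv, (hB g hgv).1 hg.2⟩
      · exact absurd ((hmove g hg.1 hgv).1 hg.2) hc

theorem exists_splits_stabilizer (h : Γ.IsTree)
    (hfg : ∀ p q, Γ.Adj p q → (stabilizer G p ⊓ stabilizer G q).FG)
    (hinf : ∀ p q, Γ.Adj p q → ((stabilizer G p ⊓ stabilizer G q : Subgroup G) : Set G).Infinite)
    (hadj : ∀ (g : G) (u v : V), Γ.Adj u v → Γ.Adj (g • u) (g • v))
    {A : Set G} (hA : AlmostInvariant A) (hA1 : A.Infinite) (hA2 : Aᶜ.Infinite) {x y : V}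
    (hxy : Γ.Adj x y)
    (hE : ∀ p q, Γ.Adj p q → ¬Splits A ((stabilizer G p ⊓ stabilizer G q : Subgroup G) : Set G)) :
    ∃ v : V, Splits A (stabilizer G v) := by
  by_contra! hno
  have hcol : ∀ p q, Γ.Adj p q → (((stabilizer G p : Set G) ∩ A).Infinite ↔
      (((stabilizer G p ⊓ stabilizer G q : Subgroup G) : Set G) ∩ A).Infinite) := by
    intro p q hpq
    constructor
    · intro hp
      by_contra hf
      have h1 : ((stabilizer G p ⊓ stabilizer G q : Subgroup G) \ A : Set G).Infinite := fun h2 =>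
        hinf p q hpq (by
          rw [← Set.inter_union_sdiff ((stabilizer G p ⊓ stabilizer G q : Subgroup G) : Set G) A]
          exact (Set.not_infinite.1 hf).union h2)
      exact hno p ⟨hp, h1.mono fun g hg => ⟨hg.1.1, hg.2⟩⟩
    · exact fun hf => hf.mono fun g hg => ⟨hg.1.1, hg.2⟩
  have hconst : ∀ p q : V, ((stabilizer G p : Set G) ∩ A).Infinite ↔
      ((stabilizer G q : Set G) ∩ A).Infinite := by
    intro p q
    obtain ⟨w⟩ := h.connected p q
    induction w with
    | nil => rfl
    | @cons p q r hpq w ih =>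
      rw [← ih, hcol p q hpq, hcol q p hpq.symm, inf_comm]
  have hfin := finite_ne_edge_color hA (hfg x y hxy) (hinf x y hxy)
  have heq : ∀ g : G, (¬Splits A ((stabilizer G (g • x) ⊓ stabilizer G (g • y) : Subgroup G) : Set G)
      ∧ ¬(g ∈ A ↔ (((stabilizer G (g • x) ⊓ stabilizer G (g • y) : Subgroup G) : Set G) ∩
        A).Infinite)) ↔ ¬(g ∈ A ↔ ((stabilizer G x : Set G) ∩ A).Infinite) := by
    intro g
    have h1 := hadj g _ _ hxy
    rw [← hcol _ _ h1, hconst (g • x) x, and_iff_right (hE _ _ h1)]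
  simp only [heq] at hfin
  by_cases hx : ((stabilizer G x : Set G) ∩ A).Infinite
  · exact hA2 (hfin.subset fun g hg h' => hg (h'.2 hx))
  · exact hA1 (hfin.subset fun g hg h' => hx (h'.1 hg))

theorem finite_inter_of_pow_mem {A : Set G} (hA : AlmostInvariant A) {D : Subgroup G}
    (hD : ((D : Set G) ∩ A).Finite) {c : G} {m : ℕ} (hm : 0 < m) (hc : c ^ m ∈ D) :
    ((Subgroup.zpowers c : Set G) ∩ A).Finite := by
  refine ((Finset.range m).finite_toSet.biUnion
    (t := fun i : ℕ => {g | g * c ^ (-(i : ℤ)) ∈ (D : Set G)} ∩ A)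
    fun i _ => (hA.finite_inter_mul_right _).2 hD).subset ?_
  rintro _ ⟨⟨n, rfl⟩, hgA⟩
  have hm' : (m : ℤ) ≠ 0 := by exact_mod_cast hm.ne'
  have h1 := Int.emod_nonneg n hm'
  have h2 := Int.emod_lt_of_pos n (by exact_mod_cast hm : (0 : ℤ) < m)
  refine Set.mem_biUnion (x := (n % m).toNat) (by simp; omega) ⟨?_, hgA⟩
  have h3 : c ^ n * c ^ (-((n % m).toNat : ℤ)) = (c ^ m) ^ (n / m) := by
    rw [← zpow_add, ← zpow_natCast, ← zpow_mul, Int.toNat_of_nonneg h1]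
    congr 1
    have := Int.emod_add_mul_ediv n m
    omega
  simp only [Set.mem_ofPred_eq, SetLike.mem_coe, h3]
  exact zpow_mem hc _

/-- If exactly one edge at `u` has its (infinite cyclic) stabilizer split by `A`, then `A` can be
replaced by an almost invariant set splitting the stabilizer of `u` but of no edge at `u`. -/
theorem exists_splits_stabilizer_of_unique_edge
    (hinf : ∀ p q, Γ.Adj p q → ((stabilizer G p ⊓ stabilizer G q : Subgroup G) : Set G).Infinite)
    {A : Set G} (hA : AlmostInvariant A) {u p r : V} (hup : Γ.Adj u p) (hur : Γ.Adj u r)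
    (hrp : r ≠ p) (hcyc : IsCyclic (stabilizer G u ⊓ stabilizer G p : Subgroup G))
    (hAp : Splits A ((stabilizer G u ⊓ stabilizer G p : Subgroup G) : Set G))
    (hE : ∀ q, Γ.Adj u q → q ≠ p →
      ¬Splits A ((stabilizer G u ⊓ stabilizer G q : Subgroup G) : Set G))
    (hadj : ∀ (g : G) (u v : V), Γ.Adj u v → Γ.Adj (g • u) (g • v)) :
    ∃ B : Set G, AlmostInvariant B ∧ Splits B (stabilizer G u) ∧ ∀ q, Γ.Adj u q →
      ¬Splits B ((stabilizer G u ⊓ stabilizer G q : Subgroup G) : Set G) := by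
  obtain ⟨c, hc⟩ := (Subgroup.isCyclic_iff_exists_zpowers_eq_top _).1 hcyc
  have hcmem : c ∈ stabilizer G u ⊓ stabilizer G p := hc ▸ Subgroup.mem_zpowers c
  have hcu : c • u = u := hcmem.1
  have hcp : c • p = p := hcmem.2
  set B : Set G := {g | ¬(g ∈ A ↔ g ∈ {g | c⁻¹ * g ∈ A})} with hB
  have hBp : (((stabilizer G u ⊓ stabilizer G p : Subgroup G) : Set G) ∩ B).Finite := by
    refine (hA c⁻¹).subset ?_
    rintro g ⟨hg, hgB⟩
    rw [← hc] at hg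
    obtain ⟨n, rfl⟩ := hg
    have h1 : c⁻¹ * c ^ n = c ^ n * c⁻¹ := ((Commute.refl c).inv_left.zpow_right n).eq
    simp only [hB, Set.mem_ofPred_eq, h1] at hgB
    exact hgB
  refine ⟨B, hA.xor (hA.preimage_mul_left c⁻¹), ?_, fun q hq => ?_⟩
  · by_contra hns
    have hK : ((stabilizer G u : Set G) ∩ B).Finite := by
      refine (not_splits.1 hns).resolve_right fun hf => hinf u p hup ?_
      rw [← Set.inter_union_sdiff ((stabilizer G u ⊓ stabilizer G p : Subgroup G) : Set G) B]
      exact hBp.union (hf.subset fun g hg => ⟨hg.1.1, hg.2⟩)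
    have hmeet : ∀ g ∈ stabilizer G u, ∃ j : ℤ, c ^ j * g ∈ (stabilizer G u : Set G) ∩ B := by
      intro g hg
      by_contra! hj
      have h1 : ∀ j : ℤ, c ^ j * g ∈ A ↔ c⁻¹ * (c ^ j * g) ∈ A := by
        intro j
        by_contra h2
        exact hj j ⟨mul_mem (zpow_mem (mem_stabilizer_iff.2 hcu) j) hg, h2⟩
      have h2 : ∀ j : ℤ, c ^ j * g ∈ A ↔ g ∈ A := by
        intro j
        induction j using Int.induction_on with
        | zero => simp
        | succ i ih =>
          rw [h1, ← mul_assoc, ← zpow_neg_one, ← zpow_add, ← ih]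
          norm_num
        | pred i ih =>
          rw [← ih, h1 (-(i : ℤ)), ← mul_assoc, ← zpow_neg_one, ← zpow_add]
          ring_nf
      rw [← hA.splits_mul_right g⁻¹, ← hc] at hAp
      have h3 : ∀ k, k ∈ {k | k * g⁻¹ ∈ (Subgroup.zpowers c : Set G)} → (k ∈ A ↔ g ∈ A) := by
        rintro k ⟨j, hj⟩
        simp only at hj
        rw [← h2 j, hj, inv_mul_cancel_right]
      by_cases hgA : g ∈ A
      · refine hAp.2 (Set.finite_empty.subset fun k hk => hk.2 ((h3 k hk.1).2 hgA))
      · refine hAp.1 (Set.finite_empty.subset fun k hk => hgA ((h3 k hk.1).1 hk.2))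
    choose! j hj using hmeet
    obtain ⟨d, hd, d', hd', hne, heq⟩ := (hinf u r hur).exists_ne_map_eq_of_mapsTo
      (f := fun g => c ^ j g * g) (fun g hg => hj g hg.1) hK
    have h1 : c ^ (-j d + j d') = d * d'⁻¹ := by
      rw [eq_mul_inv_iff_mul_eq, zpow_add, mul_assoc, ← heq, zpow_neg, inv_mul_cancel_left]
    have h2 : c ^ (-j d + j d') ∈ stabilizer G u ⊓ stabilizer G r := by
      rw [h1]; exact mul_mem hd (inv_mem hd')
    have h3 : -j d + j d' ≠ 0 := fun h0 => hne (by
      rw [h0, zpow_zero] at h1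
      exact (mul_inv_eq_one.1 h1.symm))
    have h4 : c ^ (-j d + j d').natAbs ∈ stabilizer G u ⊓ stabilizer G r := by
      rcases Int.natAbs_eq (-j d + j d') with h5 | h5
      · rw [h5, zpow_natCast] at h2; exact h2
      · rw [h5, zpow_neg, zpow_natCast] at h2; exact inv_mem_iff.1 h2
    have h5 := Int.natAbs_pos.2 h3
    rw [← hc] at hAp
    rcases not_splits.1 (hE r hur hrp) with h6 | h6
    · exact hAp.1 (finite_inter_of_pow_mem hA h6 h5 h4)
    · exact hAp.2 (finite_inter_of_pow_mem hA.compl h6 h5 h4)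
  · by_cases hqp : q = p
    · subst hqp
      exact not_splits.2 (Or.inl hBp)
    · refine not_splits_xor (hE q hq hqp) ?_
      have h1 := splits_cosetOf hA c⁻¹ u q
      rw [inv_smul_eq_iff.2 hcu.symm] at h1
      have h2 := hE (c⁻¹ • q) (by
        have := hadj c⁻¹ _ _ hq
        rwa [inv_smul_eq_iff.2 hcu.symm] at this) fun e => hqp (by
          rw [inv_smul_eq_iff, hcp] at e; exact e)
      rw [← h1, ← splits_preimage (Equiv.mulLeft c⁻¹)] at h2
      convert h2 using 2
      · rfl
      · ext g
        change _ ↔ c⁻¹⁻¹ * (c⁻¹ * g) ∈ stabilizer G u ⊓ stabilizer G q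
        rw [inv_inv, mul_inv_cancel_left, SetLike.mem_coe]

/-- Only finitely many edge stabilizers are split by a given almost invariant set. -/
theorem finite_split_edges [Group.FG G] (h : Γ.IsTree)
    (hadj : ∀ (g : G) (u v : V), Γ.Adj u v → Γ.Adj (g • u) (g • v))
    (hmin : ∀ S : Set V, S.Nonempty → (∀ g : G, ∀ x ∈ S, g • x ∈ S) →
      (Γ.induce S).Connected → S = Set.univ)
    (hfg : ∀ p q, Γ.Adj p q → (stabilizer G p ⊓ stabilizer G q).FG)
    {A : Set G} (hA : AlmostInvariant A) :
    {z : V × V | Γ.Adj z.1 z.2 ∧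
      Splits A ((stabilizer G z.1 ⊓ stabilizer G z.2 : Subgroup G) : Set G)}.Finite := by
  obtain ⟨D, hD, hDe⟩ := exists_finite_edges (G := G) h hadj hmin
  refine ((hD.subset (Set.sep_subset D fun d => Γ.Adj d.1 d.2)).biUnion
    (t := fun d => {z : V × V | (∃ g : G, g • d.1 = z.1 ∧ g • d.2 = z.2) ∧
      Splits A ((stabilizer G z.1 ⊓ stabilizer G z.2 : Subgroup G) : Set G)})
    fun d hd => ?_).subset ?_
  · refine Set.Finite.of_injOn (f := fun z : V × V => {g : G | g • d.1 = z.1 ∧ g • d.2 = z.2})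
      ?_ ?_ (hA.finite_splitCosets (hfg _ _ hd.2))
    · rintro ⟨_, _⟩ ⟨⟨g, rfl, rfl⟩, hz⟩
      rw [← splits_cosetOf hA] at hz
      have h1 : {k : G | k • d.1 = g • d.1 ∧ k • d.2 = g • d.2} =
          cosetOf g (stabilizer G d.1 ⊓ stabilizer G d.2) := by
        ext k
        simp only [Set.mem_ofPred_eq, mem_cosetOf, Subgroup.mem_inf, mem_stabilizer_iff, mul_smul,
          inv_smul_eq_iff]
      simp only [h1]
      exact ⟨⟨g, rfl⟩, hz⟩
    · rintro ⟨_, _⟩ ⟨⟨g, rfl, rfl⟩, hz⟩ z' _ heq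
      have h1 : g ∈ {k : G | k • d.1 = z'.1 ∧ k • d.2 = z'.2} :=
        (Set.ext_iff.1 heq g).1 ⟨rfl, rfl⟩
      exact Prod.ext h1.1 h1.2
  · rintro ⟨p, q⟩ ⟨hpq, hz⟩
    obtain ⟨g, d, hd, hd', h1⟩ := hDe p q hpq
    exact Set.mem_biUnion (x := d) ⟨hd, hd'⟩ ⟨⟨g, h1⟩, hz⟩

/-- A nontrivial almost invariant set can be chosen so as to split at most one vertex stabilizer. -/
theorem exists_almostInvariant [Group.FG G] (h : Γ.IsTree)
    (hadj : ∀ (g : G) (u v : V), Γ.Adj u v → Γ.Adj (g • u) (g • v))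
    (hninv : ∀ (g : G) (u v : V), Γ.Adj u v → ¬(g • u = v ∧ g • v = u))
    (hmin : ∀ S : Set V, S.Nonempty → (∀ g : G, ∀ x ∈ S, g • x ∈ S) →
      (Γ.induce S).Connected → S = Set.univ)
    (hcyc : ∀ p q : V, Γ.Adj p q → IsCyclic (stabilizer G p ⊓ stabilizer G q : Subgroup G))
    (hfg : ∀ p q, Γ.Adj p q → (stabilizer G p ⊓ stabilizer G q).FG)
    {A : Set G} (hA : AlmostInvariant A) (hA1 : A.Infinite) (hA2 : Aᶜ.Infinite) {x y : V}
    (hxy : Γ.Adj x y) :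
    ∃ u : V, ∃ B : Set G, AlmostInvariant B ∧ B.Infinite ∧ Bᶜ.Infinite ∧
      ∀ w, w ≠ u → ¬Splits B (stabilizer G w) := by
  have : Infinite G := Set.infinite_univ_iff.1 (hA1.mono (Set.subset_univ A))
  by_cases hinf : ∀ p q, Γ.Adj p q →
      ((stabilizer G p ⊓ stabilizer G q : Subgroup G) : Set G).Infinite
  swap
  · push Not at hinf
    obtain ⟨p, q, hpq, hfin⟩ := hinf
    obtain ⟨B, h1, h2, h3, h4⟩ := exists_almostInvariant_of_finite_edge h hadj hninv hmin hpq hfin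
    exact ⟨x, B, h1, h2, h3, fun w _ => h4 w⟩
  suffices hs : ∃ u : V, ∃ B : Set G, AlmostInvariant B ∧ Splits B (stabilizer G u) ∧
      ∀ q, Γ.Adj u q → ¬Splits B ((stabilizer G u ⊓ stabilizer G q : Subgroup G) : Set G) by
    obtain ⟨u, B, h1, h2, h3⟩ := hs
    exact ⟨u, exists_almostInvariant_splits_only h hadj hfg hinf h1 h2 h3⟩
  by_cases hE : ∀ p q, Γ.Adj p q →
      ¬Splits A ((stabilizer G p ⊓ stabilizer G q : Subgroup G) : Set G)
  · obtain ⟨v, hv⟩ := exists_splits_stabilizer h hfg hinf hadj hA hA1 hA2 hxy hE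
    exact ⟨v, A, hA, hv, fun q hq => hE v q hq⟩
  · push Not at hE
    obtain ⟨a, b, hab, hsp⟩ := hE
    have hZ := (finite_split_edges h hadj hmin hfg hA).subset
      (Set.sep_subset _ fun z => x ∈ Γ.half z.2 z.1)
    obtain ⟨⟨p, u⟩, ⟨⟨hpu, hpus⟩, hxu⟩, hmax⟩ := Set.exists_max_image _
      (fun z : V × V => Γ.dist x z.2) hZ (by
        by_cases hx : x ∈ Γ.half b a
        · exact ⟨(a, b), ⟨hab, hsp⟩, hx⟩
        · exact ⟨(b, a), ⟨hab.symm, by simp only; rwa [inf_comm]⟩, (h.notMem_half hab.symm).1 hx⟩)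
    simp only at hpu hpus hxu hmax
    rw [inf_comm] at hpus
    obtain ⟨r, hur, hrp⟩ := exists_adj_ne h hadj hninv hmin hpu.symm
    refine ⟨u, exists_splits_stabilizer_of_unique_edge hinf hA hpu.symm hur hrp
      (hcyc u p hpu.symm) hpus (fun q hq hqp hs => ?_) hadj⟩
    by_cases hxq : x ∈ Γ.half u q
    · exact hqp (h.eq_of_mem_half hq hpu.symm hxq hxu)
    · have h1 := (h.notMem_half hq).1 hxq
      have h2 := hmax (u, q) ⟨⟨hq, hs⟩, h1⟩
      have h3 := h.dist_eq_of_mem_half hq.symm h1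
      simp only at h2
      omega

end TreeAction

namespace FreeGroup

theorem infinite_cone_singleton {α : Type*} [DecidableEq α] (i : α) :
    (cone {(i, true)} : Set (FreeGroup α)).Infinite := by
  refine Set.infinite_of_injective_forall_mem (f := fun n : ℕ => of i ^ (n + 1))
    (fun m n h => ?_) fun n => ?_
  · simpa [toWord_of_pow] using congrArg (fun g => g.toWord.length) h
  · simp [mem_cone, toWord_of_pow, List.replicate_succ]

end FreeGroup

/-- Let T be a minimal simplicial F_N-tree (N ≥ 2) with at most cyclic edge
stabilizers. Then every edge stabilizer of T is contained in a proper free factor of F_N, and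
there is at most one conjugacy class of vertex stabilizers of T that is not contained in any
proper free factor of F_N. -/
theorem stmt13 (N : ℕ) (hN : 2 ≤ N) {V : Type*} [Nonempty V]
    (Γ : SimpleGraph V) (htree : Γ.IsTree)
    [MulAction (FreeGroup (Fin N)) V]
    (hadj : ∀ (g : FreeGroup (Fin N)) (u v : V), Γ.Adj u v → Γ.Adj (g • u) (g • v))
    (hninv : ∀ (g : FreeGroup (Fin N)) (u v : V), Γ.Adj u v → ¬ (g • u = v ∧ g • v = u))
    (hmin : ∀ S : Set V, S.Nonempty →
      (∀ (g : FreeGroup (Fin N)), ∀ x ∈ S, g • x ∈ S) →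
      (Γ.induce S).Connected → S = Set.univ)
    (hcyc : ∀ u v : V, Γ.Adj u v →
      IsCyclic ↥(MulAction.stabilizer (FreeGroup (Fin N)) u ⊓
        MulAction.stabilizer (FreeGroup (Fin N)) v)) :
    (∀ u v : V, Γ.Adj u v → ∃ A : Subgroup (FreeGroup (Fin N)), IsFreeFactor A ∧ A ≠ ⊤ ∧
      MulAction.stabilizer (FreeGroup (Fin N)) u ⊓
        MulAction.stabilizer (FreeGroup (Fin N)) v ≤ A) ∧
    ∀ u v : V,
      (¬ ∃ A : Subgroup (FreeGroup (Fin N)), IsFreeFactor A ∧ A ≠ ⊤ ∧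
        MulAction.stabilizer (FreeGroup (Fin N)) u ≤ A) →
      (¬ ∃ A : Subgroup (FreeGroup (Fin N)), IsFreeFactor A ∧ A ≠ ⊤ ∧
        MulAction.stabilizer (FreeGroup (Fin N)) v ≤ A) →
      ∃ g : FreeGroup (Fin N),
        Subgroup.map (MulAut.conj g).toMonoidHom
          (MulAction.stabilizer (FreeGroup (Fin N)) u) =
          MulAction.stabilizer (FreeGroup (Fin N)) v := by
  have hfg : ∀ p q, Γ.Adj p q →
      (MulAction.stabilizer (FreeGroup (Fin N)) p ⊓
        MulAction.stabilizer (FreeGroup (Fin N)) q).FG := by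
    intro p q hpq
    obtain ⟨c, hc⟩ := (Subgroup.isCyclic_iff_exists_zpowers_eq_top _).1 (hcyc p q hpq)
    exact ⟨{c}, by rw [Finset.coe_singleton, ← Subgroup.zpowers_eq_closure, hc]⟩
  have : Nontrivial (Fin N) := Fin.nontrivial_iff_two_le.2 hN
  by_cases hedge : ∃ x y, Γ.Adj x y
  swap
  · push Not at hedge
    refine ⟨fun u v huv => absurd huv (hedge u v), fun u v _ _ => ⟨1, ?_⟩⟩
    obtain ⟨w⟩ := htree.connected u v
    cases w with
    | nil => rw [map_one]; exact Subgroup.map_id _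
    | cons huw _ => exact absurd huw (hedge _ _)
  obtain ⟨x, y, hxy⟩ := hedge
  have hcone : ((FreeGroup.cone {((⟨0, by omega⟩ : Fin N), true)})ᶜ).Infinite := by
    refine (FreeGroup.infinite_cone_singleton (⟨1, by omega⟩ : Fin N)).mono ?_
    rintro g ⟨d, rfl, hg⟩
    rw [Set.mem_compl_iff, FreeGroup.mem_cone_of_head? hg]
    simp
  obtain ⟨u, B, hB, hB1, hB2, hBu⟩ := TreeAction.exists_almostInvariant htree hadj hninv hmin hcyc
    hfg (FreeGroup.almostInvariant_cone _) (FreeGroup.infinite_cone_singleton _) hcone hxy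
  refine ⟨fun p q hpq => ?_, fun p q hp hq => ?_⟩
  · refine FreeGroup.inProperFreeFactor_of_almostInvariant _
      (fun A hA => hA.finite_splitCosets (hfg p q hpq)) ⟨B, hB, hB1, hB2, ?_⟩
    refine splitCosets_eq_empty.2 fun g => ?_
    rw [TreeAction.splits_cosetOf hB]
    by_cases hgp : g • p = u
    · exact fun h => hBu (g • q) (hgp ▸ (hadj g p q hpq).ne') (h.mono inf_le_right)
    · exact fun h => hBu _ hgp (h.mono inf_le_left)
  · have key : ∀ w, (¬∃ A : Subgroup (FreeGroup (Fin N)), IsFreeFactor A ∧ A ≠ ⊤ ∧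
        MulAction.stabilizer (FreeGroup (Fin N)) w ≤ A) → ∃ g : FreeGroup (Fin N), g • w = u := by
      intro w hw
      by_contra! hne
      refine hw (FreeGroup.inProperFreeFactor_of_almostInvariant _ (fun A hA =>
        hA.finite_splitCosets (TreeAction.fg_stabilizer htree hadj w (hfg w)))
        ⟨B, hB, hB1, hB2, splitCosets_eq_empty.2 fun g => ?_⟩)
      rw [TreeAction.splits_cosetOf_stabilizer hB]
      exact hBu _ (hne g)
    obtain ⟨g, hg⟩ := key p hp
    obtain ⟨k, hk⟩ := key q hq
    refine ⟨k⁻¹ * g, ?_⟩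
    rw [← MulAction.stabilizer_smul_eq_stabilizer_map_conj, mul_smul, hg, ← hk, inv_smul_smul]
end
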